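/- arXiv:0912.5072 — 10 statements merged into one kernel-verified Lean document; each statement's English description precedes it below -/
import Mathlib

section
/- Let ε = 1 and m = 1. For every even integer d with d > 0 and d ∣ 2D, one has C_d(ℚ₂) ≠ ∅ if and only if d/2 − 2D(p+1) + 2D²/d ≡ 2 (mod 16). -/
/-- `CdPoints K m p q D d` says the curve `C_d` (with ε = 1), given by the homogeneous
equation `d w² = d² u⁴ - 2(p+q)D d u² z² + 4^m D² z⁴`, has a point over `K`. -/
def CdPoints (K : Type) [Field K] (m : ℕ) (p q D d : ℤ) : Prop :=
  ∃ u z w : K, ¬(u = 0 ∧ z = 0) ∧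
    (d : K) * w ^ 2 =
      (d : K) ^ 2 * u ^ 4 - 2 * ((p : K) + (q : K)) * (D : K) * (d : K) * u ^ 2 * z ^ 2
        + (4 : K) ^ m * (D : K) ^ 2 * z ^ 4

/-- `Cd'Points K p q D d` says the curve `C′_d` (with ε = 1), given by the homogeneous
equation `d w² = d² u⁴ + (p+q)D d u² z² + pq D² z⁴`, has a point over `K`. -/
def Cd'Points (K : Type) [Field K] (p q D d : ℤ) : Prop :=
  ∃ u z w : K, ¬(u = 0 ∧ z = 0) ∧
    (d : K) * w ^ 2 =
      (d : K) ^ 2 * u ^ 4 + ((p : K) + (q : K)) * (D : K) * (d : K) * u ^ 2 * z ^ 2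
        + (p : K) * (q : K) * (D : K) ^ 2 * z ^ 4

/-- An integer congruent to `1` modulo `8` is a square in `ℤ_[2]`. -/
theorem PadicInt.exists_sq_eq_one_add_eight_mul (k : ℤ) :
    ∃ r : ℤ_[2], r ^ 2 = 1 + 8 * (k : ℤ_[2]) := by
  have hF : ‖(Polynomial.X ^ 2 + Polynomial.X - Polynomial.C (2 * (k : ℤ_[2]))).aeval (0 : ℤ_[2])‖ <
      ‖(Polynomial.X ^ 2 + Polynomial.X -
        Polynomial.C (2 * (k : ℤ_[2]))).derivative.aeval (0 : ℤ_[2])‖ ^ 2 := by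
    have h : ‖((2 * k : ℤ) : ℤ_[2])‖ < 1 := (PadicInt.norm_int_lt_one_iff_dvd (2 * k)).2 ⟨k, rfl⟩
    simpa using h
  obtain ⟨y, hy, -⟩ := hensels_lemma hF
  simp only [map_sub, map_add, map_pow, Polynomial.aeval_X, Polynomial.aeval_C,
    Algebra.algebraMap_self, RingHom.id_apply] at hy
  exact ⟨1 + 2 * y, by linear_combination 4 * hy⟩

theorem Int.exists_sq_eq_of_odd {t : ℤ} (ht : Odd t) : ∃ k, t ^ 2 = 1 + 8 * k := by
  obtain ⟨k, hk⟩ := Int.eight_dvd_sq_sub_one_of_odd ht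
  exact ⟨k, by linarith⟩

/-- If `2e (u⁴ - 4sf u²z² + f²z⁴)` is a square modulo `32` with `u`, `z` not both even, then
`e - 4sef + ef² ≡ 2` modulo `16`. -/
theorem Int.modEq_two_of_sq_modEq {e f s u z w : ℤ} (he : Odd e) (hf : Odd f)
    (huz : Odd u ∨ Odd z)
    (h : w ^ 2 ≡ 2 * e * (u ^ 4 - 4 * s * f * u ^ 2 * z ^ 2 + f ^ 2 * z ^ 4) [ZMOD 32]) :
    e - 4 * s * e * f + e * f ^ 2 ≡ 2 [ZMOD 16] := by
  obtain ⟨c, hc⟩ := h.symm.dvd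
  have hw : Even w := by
    have : Even (w ^ 2) :=
      ⟨e * (u ^ 4 - 4 * s * f * u ^ 2 * z ^ 2 + f ^ 2 * z ^ 4) + 16 * c, by linarith⟩
    exact (Int.even_pow.1 this).1
  obtain ⟨y, rfl⟩ := hw
  have hy : 2 * y ^ 2 = e * (u ^ 4 - 4 * s * f * u ^ 2 * z ^ 2 + f ^ 2 * z ^ 4) + 16 * c := by
    linarith
  have hE : Even (e * (u ^ 4 - 4 * s * f * u ^ 2 * z ^ 2 + f ^ 2 * z ^ 4) + 16 * c) :=
    ⟨y ^ 2, by linarith⟩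
  have hboth : Odd u ∧ Odd z := by
    rw [← Int.not_even_iff_odd] at he hf huz ⊢
    rw [← Int.not_even_iff_odd] at huz ⊢
    have h4 : Even (4 : ℤ) := by decide
    have h16 : Even (16 : ℤ) := by decide
    simp only [Int.even_add, Int.even_sub, Int.even_mul, Int.even_pow, h4, h16] at hE
    tauto
  obtain ⟨k, hk⟩ := Int.exists_sq_eq_of_odd hboth.1
  obtain ⟨l, hl⟩ := Int.exists_sq_eq_of_odd hboth.2
  obtain ⟨a, ha⟩ := Int.exists_sq_eq_of_odd hf
  rw [show u ^ 4 = (u ^ 2) ^ 2 by ring, show z ^ 4 = (z ^ 2) ^ 2 by ring, hk, hl, ha] at hy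
  obtain ⟨e', rfl⟩ := he
  have hyodd : Odd y := by
    have : Odd (y ^ 2) := by
      by_contra hcon
      obtain ⟨b, hb⟩ := Int.not_odd_iff_even.1 hcon
      rw [hb] at hy
      ring_nf at hy
      omega
    exact (Int.odd_pow' two_ne_zero).1 this
  obtain ⟨b, hb⟩ := Int.exists_sq_eq_of_odd hyodd
  rw [hb] at hy
  refine (Int.modEq_iff_dvd.2 ?_).symm
  refine ⟨b - c - (2 * e' + 1) * (k + 4 * k ^ 2 + (1 + 8 * a) * (l + 4 * l ^ 2)
    - 2 * s * f * (k + l + 8 * k * l)), ?_⟩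
  rw [ha]
  linear_combination -hy

/-- A point over `ℚ_[2]` of `w² = 2e (u⁴ - 4sf u²z² + f²z⁴)` has integral coordinates with `u` or
`z` equal to `1`. -/
theorem Padic.exists_padicInt_point {e f s : ℤ} {u z w : ℚ_[2]} (huz : ¬(u = 0 ∧ z = 0))
    (h : w ^ 2 = 2 * e * (u ^ 4 - 4 * s * f * u ^ 2 * z ^ 2 + f ^ 2 * z ^ 4)) :
    ∃ U Z W : ℤ_[2], (U = 1 ∨ Z = 1) ∧
      W ^ 2 = 2 * e * (U ^ 4 - 4 * s * f * U ^ 2 * Z ^ 2 + f ^ 2 * Z ^ 4) := by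
  have key : ∀ (U Z : ℤ_[2]) (v : ℚ_[2]),
      v ^ 2 = 2 * e * ((U : ℚ_[2]) ^ 4 - 4 * s * f * U ^ 2 * Z ^ 2 + f ^ 2 * Z ^ 4) →
      ∃ W : ℤ_[2], W ^ 2 = 2 * e * (U ^ 4 - 4 * s * f * U ^ 2 * Z ^ 2 + f ^ 2 * Z ^ 4) := by
    intro U Z v hv
    have hcast : v ^ 2 = ((2 * e * (U ^ 4 - 4 * s * f * U ^ 2 * Z ^ 2 + f ^ 2 * Z ^ 4) : ℤ_[2]) :
        ℚ_[2]) := by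
      push_cast
      exact hv
    have hnorm : ‖v‖ ≤ 1 := by
      rw [← pow_le_one_iff_of_nonneg (norm_nonneg v) two_ne_zero, ← norm_pow, hcast]
      exact PadicInt.norm_le_one _
    exact ⟨⟨v, hnorm⟩, Subtype.ext ((PadicInt.coe_pow _ 2).trans hcast)⟩
  rcases le_total ‖u‖ ‖z‖ with hle | hle
  · have hz : z ≠ 0 := by
      rintro rfl
      exact huz ⟨by simpa using hle, rfl⟩
    have hn : ‖u / z‖ ≤ 1 := by
      rw [norm_div]
      exact div_le_one_of_le₀ hle (norm_nonneg z)
    obtain ⟨W, hW⟩ := key ⟨u / z, hn⟩ 1 (w / z ^ 2) (by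
      simp only [PadicInt.coe_one]
      field_simp
      linear_combination h)
    exact ⟨_, _, W, Or.inr rfl, hW⟩
  · have hu : u ≠ 0 := by
      rintro rfl
      exact huz ⟨rfl, by simpa using hle⟩
    have hn : ‖z / u‖ ≤ 1 := by
      rw [norm_div]
      exact div_le_one_of_le₀ hle (norm_nonneg u)
    obtain ⟨W, hW⟩ := key 1 ⟨z / u, hn⟩ (w / u ^ 2) (by
      simp only [PadicInt.coe_one]
      field_simp
      linear_combination h)
    exact ⟨_, _, W, Or.inl rfl, hW⟩

/-- For odd `e` and `f`, the curve `w² = 2e (u⁴ - 4sf u²z² + f²z⁴)` has a point over `ℚ_[2]` exactly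
when `e - 4sef + ef² ≡ 2` modulo `16`. -/
theorem Padic.exists_point_iff_modEq {e f s : ℤ} (he : Odd e) (hf : Odd f) :
    (∃ u z w : ℚ_[2], ¬(u = 0 ∧ z = 0) ∧
      w ^ 2 = 2 * e * (u ^ 4 - 4 * s * f * u ^ 2 * z ^ 2 + f ^ 2 * z ^ 4)) ↔
      e - 4 * s * e * f + e * f ^ 2 ≡ 2 [ZMOD 16] := by
  constructor
  · rintro ⟨u, z, w, huz, h⟩
    obtain ⟨U, Z, W, hUZ, hW⟩ := Padic.exists_padicInt_point huz h
    let φ := PadicInt.toZModPow (p := 2) 5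
    have reps : ∀ X : ℤ_[2], ∃ x : ℤ, (x : ZMod (2 ^ 5)) = φ X ∧ (X = 1 → Odd x) := by
      intro X
      by_cases hX : X = 1
      · exact ⟨1, by simp [hX], fun _ => odd_one⟩
      · obtain ⟨x, hx⟩ := ZMod.intCast_surjective (φ X)
        exact ⟨x, hx, fun h => absurd h hX⟩
    obtain ⟨u', hu, hu1⟩ := reps U
    obtain ⟨z', hz, hz1⟩ := reps Z
    obtain ⟨w', hw, -⟩ := reps W
    refine Int.modEq_two_of_sq_modEq he hf (hUZ.imp hu1 hz1) (w := w') ?_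
    have hφ := congrArg φ hW
    simp only [map_pow, map_mul, map_add, map_sub, map_ofNat, map_intCast, ← hu, ← hz, ← hw] at hφ
    refine (ZMod.intCast_eq_intCast_iff _ _ 32).1 ?_
    push_cast
    exact hφ
  · intro h
    obtain ⟨k, hk⟩ := h.symm.dvd
    obtain ⟨r, hr⟩ := PadicInt.exists_sq_eq_one_add_eight_mul k
    have hr' : (r : ℚ_[2]) ^ 2 = 1 + 8 * (k : ℚ_[2]) := by
      rw [← PadicInt.coe_pow, hr]
      push_cast
      rfl
    have hk' : (e : ℚ_[2]) - 4 * s * e * f + e * f ^ 2 - 2 = 16 * k := by exact_mod_cast hk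
    exact ⟨1, 1, 2 * r, by simp, by linear_combination 4 * hr' - 2 * hk'⟩

theorem stmt1
    (m : ℕ) (hm : 1 ≤ m)
    (p q : ℕ) (hp : p.Prime) (hq : q.Prime) (hpodd : Odd p) (hqodd : Odd q)
    (hpq : (q : ℤ) - (p : ℤ) = 2 ^ m)
    (D : ℤ) (hD0 : 0 < D) (hDsf : Squarefree D) (hDodd : Odd D)
    (hpD : ¬((p : ℤ) ∣ D)) (hqD : ¬((q : ℤ) ∣ D))
    (hm1 : m = 1)
    (d : ℤ) (hde : Even d) (hd0 : 0 < d) (hdD : d ∣ 2 * D) :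
    CdPoints ℚ_[2] m (p : ℤ) (q : ℤ) D d ↔
      d / 2 - 2 * D * ((p : ℤ) + 1) + 2 * D ^ 2 / d ≡ 2 [ZMOD 16] := by
  subst hm1
  obtain ⟨e, rfl⟩ := hde.two_dvd
  obtain ⟨f, rfl⟩ := (mul_dvd_mul_iff_left (two_ne_zero' ℤ)).1 hdD
  obtain ⟨he, hf⟩ := Int.odd_mul.1 hDodd
  obtain ⟨s, hs⟩ := hpodd
  have hp' : (p : ℤ) = 2 * s + 1 := by exact_mod_cast hs
  have hq' : (q : ℤ) = 2 * s + 3 := by linarith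
  have he0 : e ≠ 0 := by omega
  have hdiv : 2 * (e * f) ^ 2 / (2 * e) = e * f ^ 2 := by
    rw [show 2 * (e * f) ^ 2 = (2 * e) * (e * f ^ 2) by ring]
    exact Int.mul_ediv_cancel_left _ (by omega)
  rw [hdiv, Int.mul_ediv_cancel_left _ two_ne_zero, hp',
    show e - 2 * (e * f) * (2 * (s : ℤ) + 1 + 1) + e * f ^ 2 =
      e - 4 * (s + 1) * e * f + e * f ^ 2 by ring,
    ← Padic.exists_point_iff_modEq he hf]
  have heK : (2 * e : ℚ_[2]) ≠ 0 := mul_ne_zero two_ne_zero (by exact_mod_cast he0)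
  refine exists_congr fun u => exists_congr fun z => exists_congr fun w => and_congr_right fun _ => ?_
  rw [hq', ← mul_right_inj' heK (b := w ^ 2)]
  push_cast
  ring_nf
end

section
/- Let ε = 1 and m = 2. For every even integer d with d > 0 and d ∣ 2D, one has C_d(ℚ₂) = ∅. -/
theorem PadicInt.coe_two : ((2 : ℤ_[2]) : ℚ_[2]) = 2 :=
  PadicInt.coe_natCast 2

/-- A 2-adic number of norm less than one is twice a 2-adic integer. -/
theorem Padic.exists_eq_two_mul_of_norm_lt_one {y : ℚ_[2]} (hy : ‖y‖ < 1) :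
    ∃ t : ℤ_[2], y = 2 * (t : ℚ_[2]) := by
  have h : ((2 : ℕ) : ℤ_[2]) ∣ ⟨y, hy.le⟩ := (PadicInt.norm_lt_one_iff_dvd _).1 hy
  obtain ⟨t, ht⟩ := h
  refine ⟨t, ?_⟩
  simpa [PadicInt.coe_two] using congrArg (fun a : ℤ_[2] => (a : ℚ_[2])) ht

/-- Twice a 2-adic unit is not a square in `ℚ₂`. -/
theorem Padic.sq_ne_two_mul_one_add_two_mul (y : ℚ_[2]) (x : ℤ_[2]) :
    y ^ 2 ≠ 2 * (1 + 2 * (x : ℚ_[2])) := by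
  intro h
  have norm_two : ‖(2 : ℚ_[2])‖ < 1 := by simpa using Padic.norm_p_lt_one (p := 2)
  have norm_unit : ‖1 + 2 * (x : ℚ_[2])‖ ≤ 1 := by
    have hint := PadicInt.norm_le_one (1 + 2 * x)
    rw [PadicInt.norm_def] at hint
    simpa [PadicInt.coe_two] using hint
  have hy : ‖y‖ < 1 := by
    have hsq : ‖y‖ ^ 2 < 1 := by
      rw [← norm_pow, h, norm_mul]
      nlinarith [norm_nonneg (1 + 2 * (x : ℚ_[2])), norm_nonneg (2 : ℚ_[2])]
    exact (sq_lt_one_iff₀ (norm_nonneg y)).1 hsq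
  obtain ⟨t, rfl⟩ := Padic.exists_eq_two_mul_of_norm_lt_one hy
  have hone : (1 : ℚ_[2]) = 2 * ((t ^ 2 - x : ℤ_[2]) : ℚ_[2]) := by
    push_cast
    linear_combination -(1 / 2 : ℚ_[2]) * h
  have hlt : ‖(1 : ℚ_[2])‖ < 1 := by
    rw [hone, norm_mul]
    exact mul_lt_one_of_nonneg_of_lt_one_left (norm_nonneg _) norm_two
      (PadicInt.norm_le_one (t ^ 2 - x))
  simp at hlt

theorem stmt2
    (m : ℕ) (hm : 1 ≤ m)
    (p q : ℕ) (hp : p.Prime) (hq : q.Prime) (hpodd : Odd p) (hqodd : Odd q)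
    (hpq : (q : ℤ) - (p : ℤ) = 2 ^ m)
    (D : ℤ) (hD0 : 0 < D) (hDsf : Squarefree D) (hDodd : Odd D)
    (hpD : ¬((p : ℤ) ∣ D)) (hqD : ¬((q : ℤ) ∣ D))
    (hm2 : m = 2)
    (d : ℤ) (hde : Even d) (hd0 : 0 < d) (hdD : d ∣ 2 * D) :
    ¬ CdPoints ℚ_[2] m (p : ℤ) (q : ℤ) D d := by
  subst hm2
  rintro ⟨u, z, w, huz, h⟩
  obtain ⟨e, rfl⟩ := hde.two_dvd
  obtain ⟨f, hf⟩ := hdD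
  obtain rfl : D = e * f := by linarith
  obtain ⟨hodde, hoddf⟩ := Int.odd_mul.1 hDodd
  obtain ⟨k, rfl⟩ := hodde
  obtain ⟨l, rfl⟩ := hoddf
  have hq' : (q : ℚ_[2]) = p + 4 := by
    have hqp : (q : ℤ) = p + 4 := by linarith
    exact_mod_cast congrArg (fun a : ℤ => (a : ℚ_[2])) hqp
  have he : (2 * k + 1 : ℚ_[2]) ≠ 0 := by
    have hk : (2 * k + 1 : ℤ) ≠ 0 := by omega
    exact_mod_cast hk
  push_cast at h
  rw [hq'] at h
  replace h : w ^ 2 = 2 * (2 * k + 1) * (u ^ 4 - 2 * (p + 2) * (2 * l + 1) * u ^ 2 * z ^ 2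
      + 4 * (2 * l + 1) ^ 2 * z ^ 4) := by
    apply mul_left_cancel₀ (mul_ne_zero two_ne_zero he)
    linear_combination h
  by_cases hle : ‖z‖ ≤ ‖u‖
  · have hu : u ≠ 0 := by
      rintro rfl
      exact huz ⟨rfl, by simpa using hle⟩
    have hnorm : ‖z / u‖ ≤ 1 := by
      rw [norm_div]
      exact div_le_one_of_le₀ hle (norm_nonneg u)
    obtain ⟨t, ht⟩ : ∃ t : ℤ_[2], z / u = t := ⟨⟨z / u, hnorm⟩, rfl⟩
    obtain rfl : z = t * u := (div_eq_iff hu).1 ht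
    refine Padic.sq_ne_two_mul_one_add_two_mul (w / u ^ 2)
      (k + (2 * k + 1) * (2 * (2 * l + 1) ^ 2 * t ^ 4 - (p + 2) * (2 * l + 1) * t ^ 2)) ?_
    rw [div_pow, h]
    push_cast [PadicInt.coe_two]
    field_simp
    ring
  · rw [not_le] at hle
    have hz : z ≠ 0 := norm_pos_iff.1 ((norm_nonneg u).trans_lt hle)
    have hnorm : ‖u / z‖ < 1 := by
      rw [norm_div]
      exact (div_lt_one (norm_pos_iff.2 hz)).2 hle
    obtain ⟨t, ht⟩ := Padic.exists_eq_two_mul_of_norm_lt_one hnorm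
    obtain rfl : u = 2 * t * z := (div_eq_iff hz).1 ht
    refine Padic.sq_ne_two_mul_one_add_two_mul (w / (2 * z ^ 2))
      (k + (2 * k + 1) * (2 * l ^ 2 + 2 * l + 2 * t ^ 4 - (p + 2) * (2 * l + 1) * t ^ 2)) ?_
    rw [div_pow, h]
    push_cast [PadicInt.coe_two]
    field_simp
    ring
end

section
/- Let ε = 1 and m = 4. For every even integer d with d > 0 and d ∣ 2D, one has C_d(ℚ₂) ≠ ∅ if and only if d − Dp ≡ 1 (mod 8). -/
namespace PadicInt

theorem even_or_odd_two (x : ℤ_[2]) : Even x ∨ Odd x := by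
  obtain ⟨n, hn, hx⟩ := PadicInt.exists_mem_range (p := 2) x
  rw [PadicInt.maximalIdeal_eq_span_p, Ideal.mem_span_singleton] at hx
  obtain ⟨y, hy⟩ := hx
  interval_cases n
  · exact Or.inl ⟨y, by push_cast at hy; linear_combination hy⟩
  · exact Or.inr ⟨y, by push_cast at hy; linear_combination hy⟩

theorem not_even_of_odd_two {x : ℤ_[2]} (hx : Odd x) : ¬ Even x := by
  rintro ⟨y, hy⟩
  obtain ⟨k, hk⟩ := hx
  have h2 := PadicInt.prime_p (p := 2)
  exact h2.not_isUnit (isUnit_of_dvd_one ⟨y - k, by push_cast; linear_combination hy - hk⟩)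

theorem even_of_even_sq_two {x : ℤ_[2]} (hx : Even (x ^ 2)) : Even x :=
  (even_or_odd_two x).resolve_right fun h => not_even_of_odd_two h.pow hx

theorem exists_sq_eq_of_odd_two {x : ℤ_[2]} (hx : Odd x) : ∃ k, x ^ 2 = 8 * k + 1 := by
  obtain ⟨y, rfl⟩ := hx
  rcases even_or_odd_two y with ⟨t, rfl⟩ | ⟨t, rfl⟩
  · exact ⟨t * (2 * t + 1), by ring⟩
  · exact ⟨(2 * t + 1) * (t + 1), by ring⟩

theorem eight_dvd_of_intCast_eq_mul {n : ℤ} {k : ℤ_[2]} (h : (n : ℤ_[2]) = 8 * k) : 8 ∣ n := by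
  have := (PadicInt.pow_p_dvd_int_iff (p := 2) 3 n).1 ⟨k, by rw [h]; norm_num⟩
  simpa using this

theorem exists_sq_eq_intCast_of_modEq_one {n : ℤ} (hn : n ≡ 1 [ZMOD 8]) :
    ∃ x : ℤ_[2], x ^ 2 = n := by
  have h8 : ((2 : ℕ) ^ 3 : ℤ) ∣ 1 - n := by simpa using hn.dvd
  have hnorm : ‖((1 - n : ℤ) : ℤ_[2])‖ ≤ (2 : ℝ) ^ (-3 : ℤ) := by
    have := (PadicInt.norm_int_le_pow_iff_dvd (p := 2) (k := 1 - n) (n := 3)).2 (by simpa using h8)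
    simpa using this
  have h2 : ‖(2 : ℤ_[2])‖ = 2⁻¹ := by simpa using PadicInt.norm_p (p := 2)
  obtain ⟨x, hx, -⟩ := hensels_lemma (p := 2) (R := ℤ_[2])
    (F := Polynomial.X ^ 2 - Polynomial.C (n : ℤ_[2])) (a := 1) (by
      have : (1 : ℤ_[2]) - n = ((1 - n : ℤ) : ℤ_[2]) := by push_cast; ring
      simp only [map_sub, map_pow, Polynomial.aeval_X, Polynomial.aeval_C,
        Polynomial.derivative_X_pow, Polynomial.derivative_C, one_pow]
      simp only [Algebra.algebraMap_self, RingHom.id_apply, this]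
      refine lt_of_le_of_lt hnorm ?_
      norm_num [h2])
  exact ⟨x, by simpa [sub_eq_zero] using hx⟩

end PadicInt

open PadicInt

theorem quartic_two_adic_mod_eight {e f P : ℤ} (he : Odd e) (hf : Odd f) (hP : Odd P)
    {u z w : ℤ_[2]} (huz : Odd u ∨ Odd z)
    (h : w ^ 2 = 2 * e * (u ^ 4 - 2 * P * f * u ^ 2 * z ^ 2 + 64 * f ^ 2 * z ^ 4)) :
    e * (2 - P * f) ≡ 1 [ZMOD 8] := by
  have he' : Odd (e : ℤ_[2]) := by simpa using he.map (Int.castRingHom ℤ_[2])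
  have hf' : Odd (f : ℤ_[2]) := by simpa using hf.map (Int.castRingHom ℤ_[2])
  have hP' : Odd (P : ℤ_[2]) := by simpa using hP.map (Int.castRingHom ℤ_[2])
  have h20 : (2 : ℤ_[2]) ≠ 0 := two_ne_zero
  have conclude : ∀ {u w r : ℤ_[2]}, Odd u → w ^ 2 = e * (2 - P * f * u ^ 2) + 8 * r →
      e * (2 - P * f) ≡ 1 [ZMOD 8] := by
    intro u w r hu hw
    have hw_odd : Odd w := by
      refine (even_or_odd_two w).resolve_left fun hev => ?_
      have h1 : Odd (w ^ 2) := by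
        rw [hw, show (e : ℤ_[2]) * (2 - P * f * u ^ 2) + 8 * r =
          2 * (e + 4 * r - e * P * f * u ^ 2) + e * P * f * u ^ 2 by ring]
        exact (even_two_mul _).add_odd (((he'.mul hP').mul hf').mul hu.pow)
      exact not_even_of_odd_two h1 (hev.pow_of_ne_zero two_ne_zero)
    obtain ⟨k, hk⟩ := exists_sq_eq_of_odd_two hu
    obtain ⟨l, hl⟩ := exists_sq_eq_of_odd_two hw_odd
    refine (Int.modEq_iff_dvd.2 (eight_dvd_of_intCast_eq_mul (k := l - r + e * P * f * k) ?_)).symm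
    push_cast
    linear_combination hl - hw + (e : ℤ_[2]) * P * f * hk
  obtain ⟨w, rfl⟩ := even_iff_exists_two_mul.1
    (even_of_even_sq_two (x := w) (by rw [h, mul_assoc]; exact even_two_mul _))
  have h1 : 2 * w ^ 2 = e * (u ^ 4 - 2 * P * f * u ^ 2 * z ^ 2 + 64 * f ^ 2 * z ^ 4) :=
    mul_left_cancel₀ h20 (by linear_combination h)
  have hu : Even u := by
    refine (even_or_odd_two u).resolve_right fun hu => ?_
    refine not_even_of_odd_two (he'.mul (hu.pow (n := 4))) (even_iff_exists_two_mul.2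
      ⟨w ^ 2 + e * (P * f * u ^ 2 * z ^ 2 - 32 * f ^ 2 * z ^ 4), ?_⟩)
    linear_combination -h1
  have hz : Odd z := huz.resolve_left fun h => not_even_of_odd_two h hu
  obtain ⟨u, rfl⟩ := even_iff_exists_two_mul.1 hu
  have h2 : w ^ 2 = 4 * (e * (2 * u ^ 4 - P * f * u ^ 2 * z ^ 2 + 8 * f ^ 2 * z ^ 4)) :=
    mul_left_cancel₀ h20 (by linear_combination h1)
  obtain ⟨w, rfl⟩ := even_iff_exists_two_mul.1
    (even_of_even_sq_two (x := w) (by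
      rw [h2, show (4 : ℤ_[2]) = 2 * 2 by norm_num, mul_assoc]; exact even_two_mul _))
  have h40 : (4 : ℤ_[2]) ≠ 0 := by norm_num
  have h3 : w ^ 2 = e * (2 * u ^ 4 - P * f * u ^ 2 * z ^ 2 + 8 * f ^ 2 * z ^ 4) :=
    mul_left_cancel₀ h40 (by linear_combination h2)
  obtain ⟨k, hk⟩ := exists_sq_eq_of_odd_two hz
  rcases even_or_odd_two u with hu | hu
  · obtain ⟨u, rfl⟩ := even_iff_exists_two_mul.1 hu
    obtain ⟨w, rfl⟩ := even_iff_exists_two_mul.1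
      (even_of_even_sq_two (x := w) (by
        rw [h3]
        exact even_iff_exists_two_mul.2 ⟨e * (16 * u ^ 4 - 2 * P * f * u ^ 2 * z ^ 2
          + 4 * f ^ 2 * z ^ 4), by ring⟩))
    have h4 : w ^ 2 = e * (8 * u ^ 4 - P * f * u ^ 2 * z ^ 2 + 2 * f ^ 2 * z ^ 4) :=
      mul_left_cancel₀ h40 (by linear_combination h3)
    obtain ⟨j, hj⟩ := exists_sq_eq_of_odd_two (hf'.mul hz.pow : Odd ((f : ℤ_[2]) * z ^ 2))
    rcases even_or_odd_two u with hu | hu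
    · exfalso
      obtain ⟨u, rfl⟩ := even_iff_exists_two_mul.1 hu
      obtain ⟨w, rfl⟩ := even_iff_exists_two_mul.1
        (even_of_even_sq_two (x := w) (by
          rw [h4]
          exact even_iff_exists_two_mul.2 ⟨e * (64 * u ^ 4 - 2 * P * f * u ^ 2 * z ^ 2
            + f ^ 2 * z ^ 4), by ring⟩))
      have h5 : 2 * w ^ 2 = e * (64 * u ^ 4 - 2 * P * f * u ^ 2 * z ^ 2 + f ^ 2 * z ^ 4) :=
        mul_left_cancel₀ h20 (by linear_combination h4)
      refine not_even_of_odd_two ((he'.mul (hf'.pow (n := 2))).mul (hz.pow (n := 4)))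
        (even_iff_exists_two_mul.2 ⟨w ^ 2 - e * (32 * u ^ 4 - P * f * u ^ 2 * z ^ 2), ?_⟩)
      linear_combination -h5
    · refine conclude (u := u * z) (w := w) (r := e * u ^ 4 + 2 * e * j) (hu.mul hz) ?_
      linear_combination h4 + 2 * (e : ℤ_[2]) * hj
  · obtain ⟨j, hj⟩ := exists_sq_eq_of_odd_two (hu.pow (n := 2))
    refine conclude (u := u * z) (w := w) (r := e * f ^ 2 * z ^ 4 + 2 * e * j) (hu.mul hz) ?_
    linear_combination h3 + 2 * (e : ℤ_[2]) * hj

theorem exists_sq_eq_quartic_two_adic_iff {e f P : ℤ} (he : Odd e) (hf : Odd f) (hP : Odd P) :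
    (∃ u z w : ℚ_[2], ¬(u = 0 ∧ z = 0) ∧
      w ^ 2 = 2 * e * (u ^ 4 - 2 * P * f * u ^ 2 * z ^ 2 + 64 * f ^ 2 * z ^ 4)) ↔
      e * (2 - P * f) ≡ 1 [ZMOD 8] := by
  constructor
  · rintro ⟨u, z, w, huz, h⟩
    have integral : ∀ (u z : ℤ_[2]) (w : ℚ_[2]), Odd u ∨ Odd z →
        w ^ 2 = 2 * e * ((u : ℚ_[2]) ^ 4 - 2 * P * f * u ^ 2 * z ^ 2 + 64 * f ^ 2 * z ^ 4) →
        e * (2 - P * f) ≡ 1 [ZMOD 8] := by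
      intro u z w huz h
      have hcast : w ^ 2 = ((2 * e * (u ^ 4 - 2 * P * f * u ^ 2 * z ^ 2 + 64 * f ^ 2 * z ^ 4) :
          ℤ_[2]) : ℚ_[2]) := by
        rw [h]; push_cast; rfl
      have hw : ‖w‖ ≤ 1 := by
        have := PadicInt.norm_le_one
          (2 * e * (u ^ 4 - 2 * P * f * u ^ 2 * z ^ 2 + 64 * f ^ 2 * z ^ 4) : ℤ_[2])
        rw [PadicInt.norm_def, ← hcast, norm_pow] at this
        exact (pow_le_one_iff_of_nonneg (norm_nonneg _) two_ne_zero).1 this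
      refine quartic_two_adic_mod_eight he hf hP (w := ⟨w, hw⟩) huz (Subtype.ext ?_)
      rw [← hcast]
      rfl
    rcases le_total ‖u‖ ‖z‖ with hle | hle
    · have hz : z ≠ 0 := by
        rintro rfl
        exact huz ⟨by simpa using hle, rfl⟩
      refine integral ⟨u / z, ?_⟩ 1 (w / z ^ 2) (Or.inr odd_one) ?_
      · rw [norm_div]
        exact div_le_one_of_le₀ hle (norm_nonneg _)
      · rw [div_pow, h]
        push_cast
        field_simp
    · have hu : u ≠ 0 := by
        rintro rfl
        exact huz ⟨rfl, by simpa using hle⟩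
      refine integral 1 ⟨z / u, ?_⟩ (w / u ^ 2) (Or.inl odd_one) ?_
      · rw [norm_div]
        exact div_le_one_of_le₀ hle (norm_nonneg _)
      · rw [div_pow, h]
        push_cast
        field_simp
  · intro h
    obtain ⟨x, hx⟩ := exists_sq_eq_intCast_of_modEq_one (n := e * (2 - P * f + 8 * f ^ 2)) (by
      refine Int.ModEq.trans (Int.modEq_iff_dvd.2 ⟨-(e * f ^ 2), by ring⟩) h)
    refine ⟨2, 1, 4 * x, by simp, ?_⟩
    have hx' : (x : ℚ_[2]) ^ 2 = e * (2 - P * f + 8 * f ^ 2) := by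
      have := congrArg (fun t : ℤ_[2] => (t : ℚ_[2])) hx
      push_cast at this
      exact this
    linear_combination 16 * hx'

theorem stmt4
    (m : ℕ) (hm : 1 ≤ m)
    (p q : ℕ) (hp : p.Prime) (hq : q.Prime) (hpodd : Odd p) (hqodd : Odd q)
    (hpq : (q : ℤ) - (p : ℤ) = 2 ^ m)
    (D : ℤ) (hD0 : 0 < D) (hDsf : Squarefree D) (hDodd : Odd D)
    (hpD : ¬((p : ℤ) ∣ D)) (hqD : ¬((q : ℤ) ∣ D))
    (hm4 : m = 4)
    (d : ℤ) (hde : Even d) (hd0 : 0 < d) (hdD : d ∣ 2 * D) :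
    CdPoints ℚ_[2] m (p : ℤ) (q : ℤ) D d ↔ d - D * (p : ℤ) ≡ 1 [ZMOD 8] := by
  subst hm4
  obtain ⟨e, rfl⟩ := even_iff_exists_two_mul.1 hde
  obtain ⟨f, rfl⟩ : e ∣ D := Int.dvd_of_mul_dvd_mul_left two_ne_zero hdD
  obtain ⟨he, hf⟩ := Int.odd_mul.1 hDodd
  have hP : Odd ((p : ℤ) + 8) := ((Int.odd_coe_nat p).2 hpodd).add_even (by decide)
  have he0 : (2 * e : ℚ_[2]) ≠ 0 := by exact_mod_cast hd0.ne'
  have hqp : (q : ℚ_[2]) = p + 16 := by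
    have : (q : ℤ) = p + 16 := by linarith
    exact_mod_cast this
  have hmod : 2 * e - e * f * (p : ℤ) ≡ 1 [ZMOD 8] ↔
      e * (2 - ((p : ℤ) + 8) * f) ≡ 1 [ZMOD 8] := by
    have : 2 * e - e * f * (p : ℤ) ≡ e * (2 - ((p : ℤ) + 8) * f) [ZMOD 8] :=
      Int.modEq_iff_dvd.2 ⟨-(e * f), by ring⟩
    exact ⟨this.symm.trans, this.trans⟩
  rw [hmod, ← exists_sq_eq_quartic_two_adic_iff he hf hP, CdPoints]
  refine exists_congr fun u => exists_congr fun z => exists_congr fun w => and_congr_right fun _ => ?_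
  rw [← mul_right_inj' (b := w ^ 2) he0]
  push_cast
  rw [hqp]
  constructor <;> intro h <;> linear_combination h
end

section
/- Let ε = 1 and m ≥ 5. For every even integer d with d > 0 and d ∣ 2D, one has C_d(ℚ₂) ≠ ∅ if and only if Dp ≡ 7 (mod 8) or d − Dp ≡ 1 (mod 8). -/
theorem PadicInt.two_dvd_sub_one {v : ℤ_[2]} (hv : ¬ (2 : ℤ_[2]) ∣ v) : (2 : ℤ_[2]) ∣ v - 1 := by
  obtain ⟨n, hn, hmem⟩ := PadicInt.exists_mem_range (p := 2) v
  rw [PadicInt.maximalIdeal_eq_span_p, Ideal.mem_span_singleton] at hmem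
  push_cast at hmem
  interval_cases n
  · simp_all
  · simpa using hmem

theorem PadicInt.norm_eq_one_of_not_two_dvd {x : ℤ_[2]} (hx : ¬ (2 : ℤ_[2]) ∣ x) : ‖x‖ = 1 := by
  refine le_antisymm x.norm_le_one (not_lt.mp fun h => hx ?_)
  simpa using PadicInt.norm_lt_one_iff_dvd x |>.mp h

theorem PadicInt.not_two_dvd_of_norm_eq_one {x : ℤ_[2]} (hx : ‖x‖ = 1) : ¬ (2 : ℤ_[2]) ∣ x := by
  intro h
  have := (PadicInt.norm_lt_one_iff_dvd (p := 2) x).mpr (by simpa using h)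
  linarith

theorem PadicInt.eight_dvd_sq_sub_one {v : ℤ_[2]} (hv : ¬ (2 : ℤ_[2]) ∣ v) :
    (8 : ℤ_[2]) ∣ v ^ 2 - 1 := by
  obtain ⟨r, hr⟩ := PadicInt.two_dvd_sub_one hv
  obtain rfl : v = 1 + 2 * r := by linear_combination hr
  by_cases h : (2 : ℤ_[2]) ∣ r
  · obtain ⟨s, rfl⟩ := h
    exact ⟨s * (2 * s + 1), by ring⟩
  · obtain ⟨s, hs⟩ := PadicInt.two_dvd_sub_one h
    obtain rfl : r = 1 + 2 * s := by linear_combination hs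
    exact ⟨(1 + 2 * s) * (1 + s), by ring⟩

theorem Padic.sq_ne_two_pow_odd_mul {x : ℤ_[2]} (hx : ¬ (2 : ℤ_[2]) ∣ x) (y : ℚ_[2]) (k : ℕ) :
    y ^ 2 ≠ 2 ^ (2 * k + 1) * (x : ℚ_[2]) := by
  intro h
  have h2 : ‖(2 : ℚ_[2])‖ = 2⁻¹ := by simpa using Padic.norm_p (p := 2)
  have hn := congrArg norm h
  rw [norm_mul, norm_pow, norm_pow, h2, PadicInt.padic_norm_e_of_padicInt,
    PadicInt.norm_eq_one_of_not_two_dvd hx, mul_one] at hn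
  have hy : y ≠ 0 := by
    rintro rfl
    rw [norm_zero, zero_pow two_ne_zero] at hn
    exact absurd hn.symm (by positivity)
  rw [Padic.norm_eq_zpow_neg_valuation hy] at hn
  have hz : ((2 : ℕ) : ℝ) ^ (-y.valuation * 2) = (2 : ℕ) ^ (-(2 * k + 1 : ℤ)) := by
    rw [zpow_mul, zpow_neg _ (2 * k + 1 : ℤ)]
    rw [inv_pow] at hn
    exact_mod_cast hn
  have := zpow_right_injective₀ (by norm_num) (by norm_num) hz
  lia

theorem Padic.eight_dvd_sub_one_of_sq {x : ℤ_[2]} (hx : ¬ (2 : ℤ_[2]) ∣ x) {y : ℚ_[2]} {k : ℕ}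
    (h : y ^ 2 = 2 ^ (2 * k) * (x : ℚ_[2])) : (8 : ℤ_[2]) ∣ x - 1 := by
  have hv2 : (y / 2 ^ k) ^ 2 = (x : ℚ_[2]) := by
    rw [div_pow, h, ← pow_mul, mul_comm k 2, mul_div_cancel_left₀ _ (pow_ne_zero _ two_ne_zero)]
  have hv : ‖y / 2 ^ k‖ = 1 := by
    have hn := congrArg norm hv2
    rw [norm_pow, PadicInt.padic_norm_e_of_padicInt,
      PadicInt.norm_eq_one_of_not_two_dvd hx] at hn
    exact (pow_eq_one_iff_of_nonneg (norm_nonneg _) two_ne_zero).mp hn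
  obtain ⟨v, hvy⟩ : ∃ v : ℤ_[2], (v : ℚ_[2]) = y / 2 ^ k := ⟨⟨_, hv.le⟩, rfl⟩
  rw [← hvy] at hv hv2
  have hvx : v ^ 2 = x := Subtype.ext (by simpa using hv2)
  rw [← hvx]
  exact PadicInt.eight_dvd_sq_sub_one (PadicInt.not_two_dvd_of_norm_eq_one hv)

theorem PadicInt.exists_sq_eq_of_modEq_one {n : ℤ} (hn : n ≡ 1 [ZMOD 8]) :
    ∃ v : ℤ_[2], v ^ 2 = n := by
  obtain ⟨j, hj⟩ := hn.symm.dvd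
  have hF : ‖(Polynomial.X ^ 2 + Polynomial.X - Polynomial.C (2 * j : ℤ_[2])).aeval (0 : ℤ_[2])‖ <
      ‖(Polynomial.X ^ 2 + Polynomial.X -
        Polynomial.C (2 * j : ℤ_[2])).derivative.aeval (0 : ℤ_[2])‖ ^ 2 := by
    have h2 : ‖(2 * j : ℤ_[2])‖ < 1 :=
      (PadicInt.norm_lt_one_iff_dvd (p := 2) _).mpr (by simp)
    simpa using h2
  obtain ⟨r, hr, -⟩ := hensels_lemma hF
  simp only [map_sub, map_add, map_pow, Polynomial.aeval_X, Polynomial.aeval_C,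
    Algebra.algebraMap_self, RingHom.id_apply] at hr
  refine ⟨1 + 2 * r, ?_⟩
  have hj' : (n : ℤ_[2]) - 1 = 8 * j := by exact_mod_cast hj
  linear_combination 4 * hr - hj'

theorem Padic.eq_unit_mul_two_pow {t : ℚ_[2]} (ht : t ≠ 0) :
    ∃ u : ℤ_[2], ¬ (2 : ℤ_[2]) ∣ u ∧
      ((∃ n : ℕ, t * 2 ^ n = u) ∨ ∃ n : ℕ, t = 2 ^ (n + 1) * u) := by
  have hn : ‖t * (2 : ℚ_[2]) ^ (-t.valuation)‖ = 1 := by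
    have h2 : ‖(2 : ℚ_[2])‖ = 2⁻¹ := by simpa using Padic.norm_p (p := 2)
    rw [norm_mul, norm_zpow, h2, Padic.norm_eq_zpow_neg_valuation ht]
    simp [zpow_ne_zero]
  refine ⟨⟨_, hn.le⟩, PadicInt.not_two_dvd_of_norm_eq_one hn, ?_⟩
  rcases le_or_gt t.valuation 0 with h | h
  · obtain ⟨n, hn⟩ := Int.eq_ofNat_of_zero_le (neg_nonneg.mpr h)
    exact .inl ⟨n, by simp [hn]⟩
  · obtain ⟨n, hn⟩ := Int.eq_ofNat_of_zero_le (show 0 ≤ t.valuation - 1 by lia)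
    refine .inr ⟨n, ?_⟩
    have : t.valuation = ((n + 1 : ℕ) : ℤ) := by push_cast; lia
    simp only [this, zpow_neg, zpow_natCast]
    field_simp

theorem PadicInt.two_dvd_intCast_iff (n : ℤ) : (2 : ℤ_[2]) ∣ n ↔ 2 ∣ n := by
  simpa using PadicInt.pow_p_dvd_int_iff (p := 2) 1 n

theorem PadicInt.eight_dvd_intCast_iff (n : ℤ) : (8 : ℤ_[2]) ∣ n ↔ 8 ∣ n := by
  have := PadicInt.pow_p_dvd_int_iff (p := 2) 3 n
  norm_num at this
  exact this

theorem PadicInt.not_two_dvd_of_odd {n : ℤ} (hn : Odd n) : ¬ (2 : ℤ_[2]) ∣ n := by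
  rw [PadicInt.two_dvd_intCast_iff]
  exact fun h => (Int.not_even_iff_odd.mpr hn) (even_iff_two_dvd.mpr h)

/-- The affine form of the quartic, with `d = 2e`, `D = ef`, `p + q = 2s` and `m = l + 2`. -/
theorem Padic.exists_of_quartic {l : ℕ} {e f s : ℤ} (he : Odd e) (hf : Odd f) (hs : Odd s)
    {t y : ℚ_[2]}
    (h : y ^ 2 = 2 * e * t ^ 4 - 4 * s * (e * f) * t ^ 2 + 2 ^ (2 * l + 3) * e * f ^ 2) :
    ∃ n k : ℕ, l = n + 1 + k ∧
      (2 * 4 ^ n * e - s * (e * f) + 2 * 4 ^ k * e * f ^ 2) ≡ 1 [ZMOD 8] := by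
  have two_prime : Prime (2 : ℤ_[2]) := by simpa using PadicInt.prime_p (p := 2)
  have hodd {n : ℤ} (hn : Odd n) := PadicInt.not_two_dvd_of_odd hn
  have coe_two : ((2 : ℤ_[2]) : ℚ_[2]) = 2 := rfl
  have coe_four : ((4 : ℤ_[2]) : ℚ_[2]) = 2 ^ 2 := by
    rw [show (4 : ℤ_[2]) = 2 ^ 2 by norm_num, PadicInt.coe_pow, coe_two]
  have coe_sixteen : ((16 : ℤ_[2]) : ℚ_[2]) = 2 ^ 4 := by
    rw [show (16 : ℤ_[2]) = 2 ^ 4 by norm_num, PadicInt.coe_pow, coe_two]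
  have ht : t ≠ 0 := by
    rintro rfl
    refine Padic.sq_ne_two_pow_odd_mul (hodd (he.mul (hf.pow (n := 2)))) y (l + 1) ?_
    push_cast
    linear_combination h
  obtain ⟨u, hu, ⟨n, hn⟩ | ⟨n, hn⟩⟩ := Padic.eq_unit_mul_two_pow ht
  · refine absurd ?_ (Padic.sq_ne_two_pow_odd_mul (x := e * u ^ 4 +
      2 * (- 4 ^ n * s * (e * f) * u ^ 2 + 2 ^ (2 * l + 1) * 16 ^ n * e * f ^ 2))
      ?_ (y * 2 ^ (2 * n)) 0)
    · push_cast [coe_two, coe_four, coe_sixteen]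
      rw [← hn, mul_pow, h]
      simp only [← pow_mul]
      ring
    · rw [dvd_add_left (dvd_mul_right _ _), two_prime.dvd_mul]
      exact not_or.mpr ⟨hodd he, fun h => hu (two_prime.dvd_of_dvd_pow h)⟩
  subst hn
  rcases le_or_gt l n with hln | hln
  · obtain ⟨j, rfl⟩ := Nat.exists_eq_add_of_le hln
    refine absurd ?_ (Padic.sq_ne_two_pow_odd_mul (x := ((e * f ^ 2 : ℤ) : ℤ_[2]) +
      2 * (2 ^ (2 * l + 4 * j + 1) * e * u ^ 4 - 4 ^ j * s * (e * f) * u ^ 2)) ?_ y (l + 1))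
    · push_cast [coe_two, coe_four, coe_sixteen]
      rw [← pow_mul, h]
      ring
    · rw [dvd_add_left (dvd_mul_right _ _)]
      exact hodd (he.mul hf.pow)
  · obtain ⟨k, rfl⟩ := Nat.exists_eq_add_of_le (Nat.succ_le_of_lt hln)
    refine ⟨n, k, rfl, ?_⟩
    have h8 := Padic.eight_dvd_sub_one_of_sq (x := ((s * (e * f) : ℤ) : ℤ_[2]) * u ^ 2 +
      2 * (4 ^ n * e * u ^ 4 - s * (e * f) * u ^ 2 + 4 ^ k * e * f ^ 2)) (y := y) (k := n + 2) ?_ ?_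
    · obtain ⟨j, hj⟩ := PadicInt.eight_dvd_sq_sub_one hu
      have : (8 : ℤ_[2]) ∣
          ((2 * 4 ^ n * e - s * (e * f) + 2 * 4 ^ k * e * f ^ 2 - 1 : ℤ) : ℤ_[2]) := by
        obtain ⟨i, hi⟩ := h8
        refine ⟨i - j * (2 * 4 ^ n * e * (u ^ 2 + 1) - s * (e * f)), ?_⟩
        push_cast at hi ⊢
        linear_combination hi - (2 * 4 ^ n * e * (u ^ 2 + 1) - s * (e * f)) * hj
      exact (Int.modEq_iff_dvd.mpr ((PadicInt.eight_dvd_intCast_iff _).mp this)).symm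
    · rw [dvd_add_left (dvd_mul_right _ _), two_prime.dvd_mul]
      exact not_or.mpr ⟨hodd (hs.mul (he.mul hf)), fun h => hu (two_prime.dvd_of_dvd_pow h)⟩
    · push_cast [coe_two, coe_four, coe_sixteen]
      rw [← pow_mul, ← pow_mul, h, Nat.succ_eq_add_one]
      ring

theorem Padic.quartic_of_modEq {n k : ℕ} {e f s : ℤ}
    (h : 2 * 4 ^ n * e - s * (e * f) + 2 * 4 ^ k * e * f ^ 2 ≡ 1 [ZMOD 8]) :
    ∃ t y : ℚ_[2], y ^ 2 =
      2 * e * t ^ 4 - 4 * s * (e * f) * t ^ 2 + 2 ^ (2 * (n + 1 + k) + 3) * e * f ^ 2 := by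
  obtain ⟨v, hv⟩ := PadicInt.exists_sq_eq_of_modEq_one h
  have hv' : (v : ℚ_[2]) ^ 2 =
      2 * (2 ^ 2) ^ n * e - s * (e * f) + 2 * (2 ^ 2) ^ k * e * f ^ 2 := by
    have := congrArg ((↑) : ℤ_[2] → ℚ_[2]) hv
    rw [PadicInt.coe_pow, PadicInt.coe_intCast] at this
    push_cast at this
    rw [this]
    norm_num
  refine ⟨2 ^ (n + 1), 2 ^ (n + 2) * v, ?_⟩
  rw [mul_pow, hv']
  simp only [← pow_mul]
  ring

theorem Int.exists_quartic_modEq_iff {l : ℕ} {e f p : ℤ} (hf : Odd f) :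
    (∃ n k : ℕ, l + 3 = n + 1 + k ∧
      2 * 4 ^ n * e - (p + 2 * (8 * 2 ^ l)) * (e * f) + 2 * 4 ^ k * e * f ^ 2 ≡ 1 [ZMOD 8]) ↔
      e * f * p ≡ 7 [ZMOD 8] ∨ 2 * e - e * f * p ≡ 1 [ZMOD 8] := by
  have hf8 : f ^ 2 ≡ 1 [ZMOD 8] := (Int.modEq_iff_dvd.mpr (Int.eight_dvd_sq_sub_one_of_odd hf)).symm
  have drop (n k : ℕ) : 2 * 4 ^ n * e - (p + 2 * (8 * 2 ^ l)) * (e * f) + 2 * 4 ^ k * e * f ^ 2 ≡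
      2 * 4 ^ n * e - e * f * p + 2 * 4 ^ k * e [ZMOD 8] := by
    obtain ⟨g, hg⟩ := hf8.dvd
    exact Int.modEq_iff_dvd.mpr ⟨2 * 2 ^ l * (e * f) + 2 * 4 ^ k * e * g,
      by linear_combination (2 * 4 ^ k * e) * hg⟩
  have pow_drop (n : ℕ) : 2 * 4 ^ (n + 1) * e ≡ 0 [ZMOD 8] :=
    Int.modEq_zero_iff_dvd.mpr ⟨4 ^ n * e, by ring⟩
  have h₁ (n k : ℕ) : 2 * 4 ^ (n + 1) * e - e * f * p + 2 * 4 ^ (k + 1) * e ≡ 1 [ZMOD 8] ↔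
      e * f * p ≡ 7 [ZMOD 8] := by
    have hn := pow_drop n
    have hk := pow_drop k
    unfold Int.ModEq at *
    lia
  have h₂ (k : ℕ) : 2 * 4 ^ 0 * e - e * f * p + 2 * 4 ^ (k + 1) * e ≡ 1 [ZMOD 8] ↔
      2 * e - e * f * p ≡ 1 [ZMOD 8] := by
    have hk := pow_drop k
    rw [pow_zero, mul_one]
    unfold Int.ModEq at *
    lia
  constructor
  · rintro ⟨n, k, hnk, h⟩
    have h := (drop n k).symm.trans h
    rcases n with _ | n <;> rcases k with _ | k
    · lia
    · exact .inr ((h₂ k).mp h)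
    · exact .inr ((h₂ n).mp (by convert h using 1; ring))
    · exact .inl ((h₁ n k).mp h)
  · rintro (h | h)
    · exact ⟨1, l + 1, by lia, (drop _ _).trans ((h₁ 0 l).mpr h)⟩
    · exact ⟨0, l + 2, by lia, (drop _ _).trans ((h₂ (l + 1)).mpr h)⟩

theorem stmt5
    (m : ℕ) (hm : 1 ≤ m)
    (p q : ℕ) (hp : p.Prime) (hq : q.Prime) (hpodd : Odd p) (hqodd : Odd q)
    (hpq : (q : ℤ) - (p : ℤ) = 2 ^ m)
    (D : ℤ) (hD0 : 0 < D) (hDsf : Squarefree D) (hDodd : Odd D)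
    (hpD : ¬((p : ℤ) ∣ D)) (hqD : ¬((q : ℤ) ∣ D))
    (hm5 : 5 ≤ m)
    (d : ℤ) (hde : Even d) (hd0 : 0 < d) (hdD : d ∣ 2 * D) :
    CdPoints ℚ_[2] m (p : ℤ) (q : ℤ) D d ↔
      (D * (p : ℤ) ≡ 7 [ZMOD 8] ∨ d - D * (p : ℤ) ≡ 1 [ZMOD 8]) := by
  obtain ⟨l, rfl⟩ := Nat.exists_eq_add_of_le' hm5
  obtain ⟨e, rfl⟩ := even_iff_two_dvd.mp hde
  obtain ⟨f, rfl⟩ := (mul_dvd_mul_iff_left two_ne_zero).mp hdD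
  obtain ⟨he, hf⟩ := Int.odd_mul.mp hDodd
  have hq' : (q : ℤ) = p + 32 * 2 ^ l := by rw [pow_add] at hpq; lia
  have hp' : Odd (p : ℤ) := by exact_mod_cast hpodd
  have he0 : (e : ℚ_[2]) ≠ 0 := by
    rw [Int.cast_ne_zero]
    lia
  have hq2 : (q : ℚ_[2]) = p + 32 * 2 ^ l := by exact_mod_cast hq'
  have h4 : (4 : ℚ_[2]) ^ (l + 5) = 2 ^ (2 * (l + 5)) := by
    rw [pow_mul]
    norm_num
  rw [← Int.exists_quartic_modEq_iff (l := l) hf]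
  constructor
  · rintro ⟨u, z, w, huz, h⟩
    push_cast [hq2, h4] at h
    have hz : z ≠ 0 := by
      rintro rfl
      have hu : u ≠ 0 := by simpa using huz
      refine Padic.sq_ne_two_pow_odd_mul (PadicInt.not_two_dvd_of_odd he) (w / u ^ 2) 0 ?_
      push_cast
      field_simp
      apply mul_left_cancel₀ (mul_ne_zero two_ne_zero he0)
      linear_combination h
    refine Padic.exists_of_quartic (l := l + 3) he hf (hp'.add_even (even_two_mul _))
      (t := u / z) (y := w / z ^ 2) ?_
    push_cast
    field_simp
    apply mul_left_cancel₀ (mul_ne_zero two_ne_zero he0)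
    linear_combination h
  · rintro ⟨n, k, hnk, h⟩
    obtain ⟨t, y, hty⟩ := Padic.quartic_of_modEq h
    refine ⟨t, 1, y, by simp, ?_⟩
    rw [← hnk] at hty
    push_cast [hq2, h4, hty]
    ring
end

section
/- Let ε = 1 and let d be an even integer with d > 0 and d ∣ 2D. For every odd prime l dividing 2pqD/d (that is, l = p, l = q, or l is a prime factor of D not dividing d), one has C_d(ℚ_l) ≠ ∅ if and only if the Legendre symbol (d/l) equals 1. -/
section Padic

variable {l : ℕ} [Fact l.Prime]

theorem Padic.isSquare_intCast_of_legendreSym_eq_one (hl2 : l ≠ 2) {d : ℤ}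
    (h : legendreSym l d = 1) : IsSquare (d : ℚ_[l]) := by
  have hd0 : (d : ZMod l) ≠ 0 := fun h0 => by
    rw [(legendreSym.eq_zero_iff l d).2 h0] at h; exact zero_ne_one h
  obtain ⟨a, ha⟩ := (legendreSym.eq_one_iff l hd0).1 h
  obtain ⟨b, rfl⟩ := ZMod.intCast_surjective a
  have hlp : l.Prime := Fact.out
  have hb : ¬ (l : ℤ) ∣ 2 * b := fun hdvd => by
    rcases (Nat.prime_iff_prime_int.1 hlp).dvd_or_dvd hdvd with h2 | hb
    · exact hl2 ((Nat.prime_dvd_prime_iff_eq hlp Nat.prime_two).1 (by exact_mod_cast h2))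
    · rw [← ZMod.intCast_zmod_eq_zero_iff_dvd] at hb
      exact hd0 (by rw [ha, hb, zero_mul])
  have hdvd : (l : ℤ) ∣ b * b - d := by
    rw [← ZMod.intCast_zmod_eq_zero_iff_dvd]
    push_cast
    rw [ha, sub_self]
  have hnorm : ‖((2 * b : ℤ) : ℤ_[l])‖ = 1 := by
    refine le_antisymm (PadicInt.norm_le_one _) (not_lt.1 fun hlt => hb ?_)
    rwa [PadicInt.norm_intCast_lt_one_iff] at hlt
  have hnorm' : ‖((b * b - d : ℤ) : ℤ_[l])‖ < 1 := by
    rwa [PadicInt.norm_intCast_lt_one_iff]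
  obtain ⟨z, hz, -⟩ := hensels_lemma (p := l)
    (F := (Polynomial.X ^ 2 - Polynomial.C (d : ℤ_[l]) : Polynomial ℤ_[l])) (a := (b : ℤ_[l])) (by
      have e1 : (Polynomial.X ^ 2 - Polynomial.C (d : ℤ_[l]) : Polynomial ℤ_[l]).aeval (b : ℤ_[l])
          = ((b * b - d : ℤ) : ℤ_[l]) := by simp [pow_two]
      have e2 : (Polynomial.derivative
          (Polynomial.X ^ 2 - Polynomial.C (d : ℤ_[l]) : Polynomial ℤ_[l])).aeval (b : ℤ_[l])
          = ((2 * b : ℤ) : ℤ_[l]) := by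
        simp [one_add_one_eq_two]
      rw [e1, e2, hnorm]
      simpa using hnorm')
  refine ⟨(z : ℚ_[l]), ?_⟩
  have hz' : z * z = (d : ℤ_[l]) := by
    have : z ^ 2 - (d : ℤ_[l]) = 0 := by simpa using hz
    linear_combination this
  exact_mod_cast congrArg (fun x : ℤ_[l] => (x : ℚ_[l])) hz'.symm

/-- Norms from the unramified quadratic extension have even valuation. -/
theorem Padic.norm_sq_sub_intCast_mul_sq {d : ℤ} (hd : ¬ (l : ℤ) ∣ d)
    (h : legendreSym l d ≠ 1) (a w : ℚ_[l]) :
    ‖a ^ 2 - d * w ^ 2‖ = max ‖a‖ ‖w‖ ^ 2 := by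
  have hd1 : ‖(d : ℚ_[l])‖ = 1 := by
    refine le_antisymm (Padic.norm_int_le_one d) (not_lt.1 fun hlt => hd ?_)
    rwa [Padic.norm_intCast_lt_one_iff] at hlt
  have hdw : ‖(d : ℚ_[l]) * w ^ 2‖ = ‖w‖ ^ 2 := by rw [norm_mul, hd1, one_mul, norm_pow]
  by_cases haw : ‖a‖ = ‖w‖
  · rw [haw, max_self]
    by_cases hw : w = 0
    · subst hw
      rw [norm_zero, norm_eq_zero] at haw
      simp [haw]
    have hx : ‖a / w‖ ≤ 1 := by rw [norm_div, haw, div_self (norm_ne_zero_iff.2 hw)]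
    let x : ℤ_[l] := ⟨a / w, hx⟩
    have hxd : ‖x ^ 2 - (d : ℤ_[l])‖ = 1 := by
      refine le_antisymm (PadicInt.norm_le_one _) (not_lt.1 fun hlt => h ?_)
      have hmem : x ^ 2 - (d : ℤ_[l]) ∈ RingHom.ker (PadicInt.toZMod (p := l)) := by
        rw [PadicInt.ker_toZMod, IsLocalRing.mem_maximalIdeal]
        exact PadicInt.mem_nonunits.2 hlt
      rw [RingHom.mem_ker, map_sub, map_pow, map_intCast, sub_eq_zero] at hmem
      have hd0 : (d : ZMod l) ≠ 0 := by rwa [Ne, ZMod.intCast_zmod_eq_zero_iff_dvd]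
      exact (legendreSym.eq_one_iff l hd0).2 ⟨_, by rw [← hmem, pow_two]⟩
    have hfac : a ^ 2 - d * w ^ 2 = w ^ 2 * ((x ^ 2 - (d : ℤ_[l]) : ℤ_[l]) : ℚ_[l]) := by
      have : (x : ℚ_[l]) = a / w := rfl
      push_cast
      rw [this]
      field_simp
    rw [hfac, norm_mul, ← PadicInt.norm_def, hxd, mul_one, norm_pow]
  · have hne : ‖a ^ 2‖ ≠ ‖-((d : ℚ_[l]) * w ^ 2)‖ := by
      rw [norm_neg, hdw, norm_pow]
      exact fun he => haw ((pow_left_inj₀ (norm_nonneg _) (norm_nonneg _) two_ne_zero).1 he)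
    rw [sub_eq_add_neg, Padic.add_eq_max_of_ne hne, norm_neg, hdw, norm_pow]
    rcases le_total ‖a‖ ‖w‖ with hle | hle
    · rw [max_eq_right hle, max_eq_right (pow_le_pow_left₀ (norm_nonneg _) hle 2)]
    · rw [max_eq_left hle, max_eq_left (pow_le_pow_left₀ (norm_nonneg _) hle 2)]

theorem Padic.eq_zero_of_sq_sub_mul_sq_eq {d c : ℤ} (hd : ¬ (l : ℤ) ∣ d)
    (h : legendreSym l d ≠ 1) (hc : ¬ (l : ℤ) ∣ c) {a w t : ℚ_[l]}
    (heq : a ^ 2 - d * w ^ 2 = ((l * c : ℤ) : ℚ_[l]) * t ^ 2) : a = 0 ∧ t = 0 := by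
  have hN := Padic.norm_sq_sub_intCast_mul_sq hd h a w
  have hl1 : (1 : ℝ) < l := by exact_mod_cast (Fact.out : l.Prime).one_lt
  have hc1 : ‖(c : ℚ_[l])‖ = 1 := by
    refine le_antisymm (Padic.norm_int_le_one c) (not_lt.1 fun hlt => hc ?_)
    rwa [Padic.norm_intCast_lt_one_iff] at hlt
  have ht : t = 0 := by
    by_contra ht
    obtain ⟨y, hy⟩ : ∃ y : ℚ_[l], ‖y‖ = max ‖a‖ ‖w‖ := by
      rcases max_choice ‖a‖ ‖w‖ with hm | hm
      · exact ⟨a, hm.symm⟩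
      · exact ⟨w, hm.symm⟩
    rw [heq, ← hy, norm_mul, norm_pow] at hN
    push_cast at hN
    rw [norm_mul, hc1, mul_one, Padic.norm_p] at hN
    have hy0 : y ≠ 0 := by
      rintro rfl
      rw [norm_zero, zero_pow two_ne_zero] at hN
      have : (l : ℝ) ≠ 0 := by positivity
      exact mul_ne_zero (inv_ne_zero this) (pow_ne_zero 2 (norm_ne_zero_iff.2 ht)) hN
    rw [Padic.norm_eq_zpow_neg_valuation ht, Padic.norm_eq_zpow_neg_valuation hy0,
      ← zpow_natCast, ← zpow_natCast, ← zpow_mul, ← zpow_mul, ← zpow_neg_one,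
      ← zpow_add₀ (by positivity)] at hN
    have := zpow_right_injective₀ (by positivity) hl1.ne' hN
    push_cast at this
    omega
  refine ⟨?_, ht⟩
  rw [heq, ht] at hN
  have hmax : max ‖a‖ ‖w‖ = 0 := by simpa using hN.symm
  exact norm_eq_zero.1 (le_antisymm (hmax ▸ le_max_left _ _) (norm_nonneg _))

end Padic

theorem CdPoints.of_isSquare {K : Type} [Field K] {m : ℕ} {p q D d : ℤ}
    (h : IsSquare (d : K)) : CdPoints K m p q D d := by
  obtain ⟨s, hs⟩ := h
  exact ⟨1, 0, s, by simp, by rw [hs]; ring⟩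

/-- Completing the square with `X ∓ 2 ^ m Y` leaves `4 r X Y`, where `r` is `p` or `q`. -/
theorem CdPoints.legendreSym_eq_one {l : ℕ} [Fact l.Prime] (hl2 : l ≠ 2) {m : ℕ}
    {p q D d r s c : ℤ} (hd : ¬ (l : ℤ) ∣ d) (hD0 : D ≠ 0) (hrs : p + q = 2 * r + s)
    (hs : s ^ 2 = 4 ^ m) (hrD : r * D = l * c) (hc : ¬ (l : ℤ) ∣ c)
    (h : CdPoints ℚ_[l] m p q D d) : legendreSym l d = 1 := by
  by_contra hleg
  obtain ⟨u, z, w, huz, heq⟩ := h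
  have hlp := Nat.prime_iff_prime_int.1 (Fact.out : l.Prime)
  have hl2' : ¬ (l : ℤ) ∣ 2 := fun h2 =>
    hl2 ((Nat.prime_dvd_prime_iff_eq Fact.out Nat.prime_two).1 (by exact_mod_cast h2))
  have hc' : ¬ (l : ℤ) ∣ 2 * 2 * d * c := by
    simp only [hlp.dvd_mul]
    tauto
  have hrs' : (p : ℚ_[l]) + q = 2 * r + s := by exact_mod_cast congrArg (Int.cast (R := ℚ_[l])) hrs
  have hs' : (s : ℚ_[l]) ^ 2 = 4 ^ m := by exact_mod_cast congrArg (Int.cast (R := ℚ_[l])) hs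
  have hrD' : (r : ℚ_[l]) * D = l * c := by exact_mod_cast congrArg (Int.cast (R := ℚ_[l])) hrD
  obtain ⟨ha, ht⟩ := Padic.eq_zero_of_sq_sub_mul_sq_eq hd hleg hc'
    (a := d * u ^ 2 - s * D * z ^ 2) (w := w) (t := u * z) (by
      push_cast
      rw [heq, hrs', ← hs']
      linear_combination 4 * (d : ℚ_[l]) * u ^ 2 * z ^ 2 * hrD')
  have hd0 : (d : ℚ_[l]) ≠ 0 := by
    rw [Int.cast_ne_zero]; rintro rfl; exact hd (dvd_zero _)
  have hD0' : (D : ℚ_[l]) ≠ 0 := Int.cast_ne_zero.2 hD0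
  have hs0 : (s : ℚ_[l]) ≠ 0 := by
    intro h0
    rw [h0] at hs'
    have : (4 : ℚ_[l]) ^ m ≠ 0 := pow_ne_zero _ (by norm_num)
    exact this (by rw [← hs']; ring)
  rcases mul_eq_zero.1 ht with rfl | rfl
  · refine huz ⟨rfl, ?_⟩
    simpa [hD0', hs0] using ha
  · refine huz ⟨?_, rfl⟩
    simpa [hd0] using ha

theorem stmt6
    (m : ℕ) (hm : 1 ≤ m)
    (p q : ℕ) (hp : p.Prime) (hq : q.Prime) (hpodd : Odd p) (hqodd : Odd q)
    (hpq : (q : ℤ) - (p : ℤ) = 2 ^ m)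
    (D : ℤ) (hD0 : 0 < D) (hDsf : Squarefree D) (hDodd : Odd D)
    (hpD : ¬((p : ℤ) ∣ D)) (hqD : ¬((q : ℤ) ∣ D))
    (d : ℤ) (hde : Even d) (hd0 : 0 < d) (hdD : d ∣ 2 * D) :
    ∀ l : ℕ, ∀ hl : l.Prime, l ≠ 2 → (l : ℤ) ∣ 2 * (p : ℤ) * (q : ℤ) * D / d →
      (letI : Fact l.Prime := ⟨hl⟩;
        (CdPoints ℚ_[l] m (p : ℤ) (q : ℤ) D d ↔ legendreSym l d = 1)) := by
  intro l hl hl2 hldvd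
  have : Fact l.Prime := ⟨hl⟩
  have hlp := Nat.prime_iff_prime_int.1 hl
  have eq_of_dvd {r : ℕ} (hr : r.Prime) (h : (l : ℤ) ∣ r) : l = r :=
    (Nat.prime_dvd_prime_iff_eq hl hr).1 (by exact_mod_cast h)
  have hl2' : ¬ (l : ℤ) ∣ 2 := fun h => hl2 (eq_of_dvd Nat.prime_two (by exact_mod_cast h))
  have hs : ((2 : ℤ) ^ m) ^ 2 = 4 ^ m := by rw [← pow_mul, mul_comm, pow_mul]; norm_num
  have hsq {c : ℤ} (hc : D = l * c) : ¬ (l : ℤ) ∣ c := fun ⟨e, he⟩ =>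
    hlp.not_isUnit (hDsf l ⟨e, by rw [hc, he]; ring⟩)
  obtain ⟨k, hk⟩ := hdD
  have hdiv : 2 * (p : ℤ) * q * D / d = p * q * k := by
    rw [show 2 * (p : ℤ) * q * D = d * (p * q * k) by linear_combination (p : ℤ) * q * hk]
    exact Int.mul_ediv_cancel_left _ hd0.ne'
  rw [hdiv, hlp.dvd_mul, hlp.dvd_mul] at hldvd
  have hd : ¬ (l : ℤ) ∣ d := by
    intro h
    have hlD : (l : ℤ) ∣ D := (hlp.dvd_or_dvd (hk ▸ h.mul_right k)).resolve_left hl2'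
    rcases hldvd with (h' | h') | h'
    · exact hpD (eq_of_dvd hp h' ▸ hlD)
    · exact hqD (eq_of_dvd hq h' ▸ hlD)
    · obtain ⟨c, hc⟩ := hlD
      have h2 : (l : ℤ) * l ∣ l * (2 * c) := by
        rw [show (l : ℤ) * (2 * c) = d * k by rw [← hk, hc]; ring]
        exact mul_dvd_mul h h'
      exact (hlp.dvd_or_dvd ((mul_dvd_mul_iff_left hlp.ne_zero).1 h2)).elim hl2' (hsq hc)
  refine ⟨fun h => ?_, fun h => .of_isSquare (Padic.isSquare_intCast_of_legendreSym_eq_one hl2 h)⟩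
  rcases hldvd with (h' | h') | h'
  · obtain rfl := eq_of_dvd hp h'
    exact h.legendreSym_eq_one hl2 hd hD0.ne' (r := l) (s := 2 ^ m) (by linarith) hs rfl hpD
  · obtain rfl := eq_of_dvd hq h'
    exact h.legendreSym_eq_one hl2 hd hD0.ne' (r := l) (s := -2 ^ m) (by linarith)
      (by rw [neg_sq, hs]) rfl hqD
  · obtain ⟨c, hc⟩ : (l : ℤ) ∣ D :=
      (hlp.dvd_or_dvd (hk ▸ h'.mul_left d)).resolve_left hl2'
    refine h.legendreSym_eq_one hl2 hd hD0.ne' (r := p) (s := 2 ^ m) (c := p * c) (by linarith) hs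
      (by rw [hc]; ring) fun hdvd => ?_
    rcases hlp.dvd_or_dvd hdvd with hp' | hc'
    · exact hpD (eq_of_dvd hp hp' ▸ ⟨c, hc⟩)
    · exact hsq hc hc'
end

section
/- Let ε = 1 and let d be an even integer with d > 0 and d ∣ 2D. For every odd prime l dividing d, one has C_d(ℚ_l) ≠ ∅ if and only if the Legendre symbols (pDd·l⁻²/l) and (qDd·l⁻²/l) both equal 1, where pDd·l⁻² and qDd·l⁻² denote the integers pDd/l² and qDd/l² (note l² ∣ Dd since l divides both D and d exactly once). -/
theorem PadicInt.exists_sq_eq_of_legendreSym_eq_one (l : ℕ) [Fact l.Prime] (hl : l ≠ 2) (n : ℤ)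
    (h : legendreSym l n = 1) : ∃ x : ℤ_[l], x ^ 2 = n := by
  have hn : (n : ZMod l) ≠ 0 := by
    intro h0
    rw [(legendreSym.eq_zero_iff l n).2 h0] at h
    exact zero_ne_one h
  obtain ⟨y, hy⟩ := (legendreSym.eq_one_iff l hn).1 h
  obtain ⟨c, rfl⟩ := ZMod.intCast_surjective y
  have hc : (c : ZMod l) ≠ 0 := by
    rintro h0
    exact hn (by rw [hy, h0, zero_mul])
  have h2 : (2 : ZMod l) ≠ 0 :=
    Ring.two_ne_zero (by rwa [ZMod.ringChar_zmod_n])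
  let F : Polynomial ℤ_[l] := Polynomial.X ^ 2 - Polynomial.C (n : ℤ_[l])
  have hF : F.aeval (c : ℤ_[l]) = ((c ^ 2 - n : ℤ) : ℤ_[l]) := by simp [F]
  have hF' : F.derivative.aeval (c : ℤ_[l]) = ((2 * c : ℤ) : ℤ_[l]) := by
    simp [F, one_add_one_eq_two]
  have hnorm : ‖F.aeval (c : ℤ_[l])‖ < ‖F.derivative.aeval (c : ℤ_[l])‖ ^ 2 := by
    have h1 : ‖((2 * c : ℤ) : ℤ_[l])‖ = 1 := by
      refine le_antisymm (PadicInt.norm_le_one _) (not_lt.1 fun hlt => ?_)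
      rw [PadicInt.norm_int_lt_one_iff_dvd, ← ZMod.intCast_zmod_eq_zero_iff_dvd] at hlt
      push_cast at hlt
      exact (mul_ne_zero h2 hc) hlt
    rw [hF, hF', h1, one_pow, PadicInt.norm_int_lt_one_iff_dvd, ← ZMod.intCast_zmod_eq_zero_iff_dvd]
    push_cast
    rw [hy]; ring
  obtain ⟨z, hz, -⟩ := hensels_lemma hnorm
  refine ⟨z, ?_⟩
  simpa [F, sub_eq_zero] using hz

/-- If `l X` is a unit times a square, with `X` integral, then `l` divides `X`. -/
theorem PadicInt.toZMod_eq_zero_of_mul_sq_eq (l : ℕ) [Fact l.Prime] (e X : ℤ_[l]) (w : ℚ_[l])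
    (he : PadicInt.toZMod e ≠ 0) (h : (e : ℚ_[l]) * w ^ 2 = l * X) : PadicInt.toZMod X = 0 := by
  have hmem : ∀ x : ℤ_[l], PadicInt.toZMod x = 0 ↔ (l : ℤ_[l]) ∣ x := fun x => by
    rw [← RingHom.mem_ker, PadicInt.ker_toZMod, PadicInt.maximalIdeal_eq_span_p,
      Ideal.mem_span_singleton]
  have hle : ‖(e : ℚ_[l])‖ = 1 := by
    refine le_antisymm (PadicInt.norm_le_one e) (not_lt.1 fun hlt => he ?_)
    rw [hmem]
    exact (PadicInt.norm_lt_one_iff_dvd e).1 hlt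
  have hw : ‖w‖ ≤ 1 := by
    have := congrArg norm h
    rw [norm_mul, hle, one_mul, norm_pow, norm_mul] at this
    have h1 : ‖(l : ℚ_[l])‖ ≤ 1 := PadicInt.norm_le_one (l : ℤ_[l])
    have h2 : ‖(X : ℚ_[l])‖ ≤ 1 := PadicInt.norm_le_one X
    have h3 : ‖w‖ ^ 2 ≤ 1 := by
      rw [this]; exact mul_le_one₀ h1 (norm_nonneg _) h2
    exact (sq_le_one_iff₀ (norm_nonneg _)).1 h3
  obtain ⟨w, rfl⟩ : ∃ w' : ℤ_[l], (w' : ℚ_[l]) = w := ⟨⟨w, hw⟩, rfl⟩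
  have h' : e * w ^ 2 = l * X := PadicInt.ext (by push_cast; exact h)
  have hw0 : PadicInt.toZMod w = 0 := by
    have := congrArg PadicInt.toZMod h'
    simpa [he] using this
  obtain ⟨v, rfl⟩ := (hmem w).1 hw0
  have hl0 : (l : ℤ_[l]) ≠ 0 := by exact_mod_cast (Fact.out : l.Prime).ne_zero
  exact (hmem X).2 ⟨e * v ^ 2, mul_left_cancel₀ hl0 (by rw [← h']; ring)⟩

/-- If `(e u² - (p + q) E z²)² = 4 p q E² z⁴` in a field, with `p, q, e, E, p - q` nonzero, then
`p E e` is a square. -/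
theorem isSquare_of_quartic_eq_zero {F : Type*} [Field F] (h2 : (2 : F) ≠ 0) {p q e E u z : F}
    (he : e ≠ 0) (hE : E ≠ 0) (hp : p ≠ 0) (hpq : p ≠ q) (hz : ¬(u = 0 ∧ z = 0))
    (h : e ^ 2 * u ^ 4 - 2 * (p + q) * E * e * u ^ 2 * z ^ 2 + (q - p) ^ 2 * E ^ 2 * z ^ 4 = 0) :
    IsSquare (p * E * e) := by
  have hz0 : z ≠ 0 := by
    rintro rfl
    refine hz ⟨?_, rfl⟩
    simpa [he] using h
  obtain ⟨s, hs⟩ : ∃ s, e * u ^ 2 = (p + q + 2 * s) * E * z ^ 2 :=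
    ⟨(e * u ^ 2 / (E * z ^ 2) - p - q) / 2, by field_simp; ring⟩
  have hs2 : s ^ 2 = p * q := by
    have : 4 * (s ^ 2 - p * q) * (E ^ 2 * z ^ 4) = 0 := by
      linear_combination h - (e * u ^ 2 + (p + q + 2 * s) * E * z ^ 2 - 2 * (p + q) * E * z ^ 2) * hs
    have h4 : (4 : F) ≠ 0 := by
      rw [show (4 : F) = 2 * 2 by norm_num]; exact mul_ne_zero h2 h2
    have := (mul_eq_zero.1 this).resolve_right (by positivity)
    exact sub_eq_zero.1 ((mul_eq_zero.1 this).resolve_left h4)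
  have hps : p + s ≠ 0 := by
    intro h0
    apply hpq
    apply mul_left_cancel₀ hp
    linear_combination hs2 + (p - s) * h0
  refine ⟨p * e * u / ((p + s) * z), ?_⟩
  field_simp
  linear_combination (-p) * hs + E * z ^ 2 * hs2

/-- A point on a curve `d w² = A u⁴ + B u² z² + C z⁴` over `ℚ_[l]` can be rescaled so that `u` and
`z` are integral and not both divisible by `l`. -/
theorem Padic.exists_integral_quartic_point {l : ℕ} [Fact l.Prime] {d A B C u z w : ℚ_[l]}
    (huz : ¬(u = 0 ∧ z = 0)) (h : d * w ^ 2 = A * u ^ 4 + B * u ^ 2 * z ^ 2 + C * z ^ 4) :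
    ∃ (u' z' : ℤ_[l]) (w' : ℚ_[l]), ¬(PadicInt.toZMod u' = 0 ∧ PadicInt.toZMod z' = 0) ∧
      d * w' ^ 2 = A * u' ^ 4 + B * u' ^ 2 * z' ^ 2 + C * z' ^ 4 := by
  rcases le_total ‖z‖ ‖u‖ with hle | hle
  · have hu : u ≠ 0 := by
      rintro rfl
      exact huz ⟨rfl, by simpa using hle⟩
    have hn : ‖z / u‖ ≤ 1 := by rw [norm_div]; exact div_le_one_of_le₀ hle (norm_nonneg _)
    refine ⟨1, ⟨z / u, hn⟩, w / u ^ 2, by simp, ?_⟩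
    simp only [PadicInt.coe_one]
    field_simp
    linear_combination h
  · have hz : z ≠ 0 := by
      rintro rfl
      exact huz ⟨by simpa using hle, rfl⟩
    have hn : ‖u / z‖ ≤ 1 := by rw [norm_div]; exact div_le_one_of_le₀ hle (norm_nonneg _)
    refine ⟨⟨u / z, hn⟩, 1, w / z ^ 2, by simp, ?_⟩
    simp only [PadicInt.coe_one]
    field_simp
    linear_combination h

theorem stmt7
    (m : ℕ) (hm : 1 ≤ m)
    (p q : ℕ) (hp : p.Prime) (hq : q.Prime) (hpodd : Odd p) (hqodd : Odd q)
    (hpq : (q : ℤ) - (p : ℤ) = 2 ^ m)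
    (D : ℤ) (hD0 : 0 < D) (hDsf : Squarefree D) (hDodd : Odd D)
    (hpD : ¬((p : ℤ) ∣ D)) (hqD : ¬((q : ℤ) ∣ D))
    (d : ℤ) (hde : Even d) (hd0 : 0 < d) (hdD : d ∣ 2 * D) :
    ∀ l : ℕ, ∀ hl : l.Prime, l ≠ 2 → (l : ℤ) ∣ d →
      (letI : Fact l.Prime := ⟨hl⟩;
        (CdPoints ℚ_[l] m (p : ℤ) (q : ℤ) D d ↔
          (legendreSym l ((p : ℤ) * D * d / (l : ℤ) ^ 2) = 1 ∧
            legendreSym l ((q : ℤ) * D * d / (l : ℤ) ^ 2) = 1))) := by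
  intro l hl hl2 hld
  have : Fact l.Prime := ⟨hl⟩
  have hlZ : Prime (l : ℤ) := Nat.prime_iff_prime_int.1 hl
  have hl2' : ¬(l : ℤ) ∣ 2 := fun h =>
    hl2 ((Nat.prime_dvd_prime_iff_eq hl Nat.prime_two).1 (by exact_mod_cast h))
  have hlD : (l : ℤ) ∣ D := (hlZ.dvd_or_dvd (hld.trans hdD)).resolve_left hl2'
  have hlp : ¬(l : ℤ) ∣ p := fun h =>
    hpD ((Nat.prime_dvd_prime_iff_eq hl hp).1 (by exact_mod_cast h) ▸ hlD)
  have hlq : ¬(l : ℤ) ∣ q := fun h =>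
    hqD ((Nat.prime_dvd_prime_iff_eq hl hq).1 (by exact_mod_cast h) ▸ hlD)
  obtain ⟨e, rfl⟩ := hld
  obtain ⟨E, rfl⟩ := hlD
  have hlE : ¬(l : ℤ) ∣ E := fun h => hlZ.not_isUnit (hDsf l (mul_dvd_mul_left _ h))
  have hle : ¬(l : ℤ) ∣ e := fun h => by
    have h2 : e ∣ 2 * E := by
      rw [mul_left_comm] at hdD
      exact (mul_dvd_mul_iff_left hlZ.ne_zero).1 hdD
    exact (hlZ.dvd_or_dvd (h.trans h2)).elim hl2' hlE
  have hdiv : ∀ r : ℤ, r * (l * E) * (l * e) / (l : ℤ) ^ 2 = r * E * e := fun r => by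
    rw [show r * (l * E) * (l * e) = r * E * e * (l : ℤ) ^ 2 by ring,
      Int.mul_ediv_cancel _ (pow_ne_zero 2 hlZ.ne_zero)]
  have h4 : (4 : ℤ) ^ m = (q - p) ^ 2 := by
    rw [hpq, ← pow_mul, mul_comm, pow_mul]; norm_num
  have hcast : ∀ {n : ℤ}, ¬(l : ℤ) ∣ n → (n : ZMod l) ≠ 0 := fun h h0 =>
    h ((ZMod.intCast_zmod_eq_zero_iff_dvd _ _).1 h0)
  have hlQ : (l : ℚ_[l]) ≠ 0 := by exact_mod_cast hl.ne_zero
  have h4Q : (4 : ℚ_[l]) ^ m = (q - p) ^ 2 := by exact_mod_cast congrArg (Int.cast : ℤ → ℚ_[l]) h4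
  rw [hdiv, hdiv]
  constructor
  · rintro ⟨u, z, w, huz, h⟩
    obtain ⟨u', z', w', huz', h'⟩ := Padic.exists_integral_quartic_point
      (A := ((l * e : ℤ) : ℚ_[l]) ^ 2)
      (B := -(2 * (((p : ℤ) : ℚ_[l]) + ((q : ℤ) : ℚ_[l])) * ((l * E : ℤ) : ℚ_[l])
        * ((l * e : ℤ) : ℚ_[l])))
      (C := (4 : ℚ_[l]) ^ m * ((l * E : ℤ) : ℚ_[l]) ^ 2) huz (h.trans (by ring))
    have hred := PadicInt.toZMod_eq_zero_of_mul_sq_eq l (e : ℤ_[l])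
      ((e : ℤ_[l]) ^ 2 * u' ^ 4 - 2 * (p + q) * E * e * u' ^ 2 * z' ^ 2
        + (q - p) ^ 2 * E ^ 2 * z' ^ 4) w' (by simpa using hcast hle) (by
          apply mul_left_cancel₀ hlQ
          push_cast at h' ⊢
          rw [show ((2 : ℤ_[l]) : ℚ_[l]) = 2 from rfl]
          linear_combination h' + l ^ 2 * E ^ 2 * z' ^ 4 * h4Q)
    have h2 := hcast hl2'
    have he := hcast hle
    have hE := hcast hlE
    have hp0 := hcast hlp
    have hq0 := hcast hlq
    have hqp : ((q - p : ℤ) : ZMod l) ≠ 0 := hcast fun h => hl2' (hlZ.dvd_of_dvd_pow (hpq ▸ h))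
    push_cast at h2 hp0 hq0 hqp
    simp only [map_add, map_sub, map_mul, map_pow, map_natCast, map_intCast, map_ofNat] at hred
    have hz : ¬(PadicInt.toZMod u' = 0 ∧ PadicInt.toZMod z' = 0) := huz'
    constructor
    · rw [legendreSym.eq_one_iff l (by push_cast; exact mul_ne_zero (mul_ne_zero hp0 hE) he)]
      push_cast
      exact isSquare_of_quartic_eq_zero h2 he hE hp0 (sub_ne_zero.1 hqp).symm hz hred
    · rw [legendreSym.eq_one_iff l (by push_cast; exact mul_ne_zero (mul_ne_zero hq0 hE) he)]
      push_cast
      exact isSquare_of_quartic_eq_zero h2 he hE hq0 (sub_ne_zero.1 hqp) hz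
        (by linear_combination hred)
  · rintro ⟨h1, h2⟩
    obtain ⟨a, ha⟩ := PadicInt.exists_sq_eq_of_legendreSym_eq_one l hl2 _ h1
    obtain ⟨b, hb⟩ := PadicInt.exists_sq_eq_of_legendreSym_eq_one l hl2 _ h2
    have haQ := congrArg (Subtype.val : ℤ_[l] → ℚ_[l]) ha
    have hbQ := congrArg (Subtype.val : ℤ_[l] → ℚ_[l]) hb
    push_cast at haQ hbQ
    have he0 : (e : ℚ_[l]) ≠ 0 := by
      rintro h0
      exact hle (by rw [Int.cast_eq_zero.1 h0]; exact dvd_zero _)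
    refine ⟨a + b, e, 0, fun h => he0 h.2, ?_⟩
    push_cast
    rw [h4Q]
    have hu : (e : ℚ_[l]) * (a + b) ^ 2 - (p + q) * E * e ^ 2 = 2 * a * b * e := by
      linear_combination e * haQ + e * hbQ
    have hab : (a : ℚ_[l]) ^ 2 * b ^ 2 = p * E * e * (q * E * e) := by rw [haQ, hbQ]
    linear_combination (-(l : ℚ_[l]) ^ 2 * (e * (a + b) ^ 2 - (p + q) * E * e ^ 2 + 2 * a * b * e)) * hu
      - 4 * l ^ 2 * e ^ 2 * hab
end

section
/- Let ε = 1 and let d be a positive integer with d ∣ D. Then: if m = 1, C_d(ℚ₂) ≠ ∅ if and only if d ≡ 1 (mod 4); if m = 2, C_d(ℚ₂) ≠ ∅ if and only if d ≡ 1 (mod 4) or 2d − D(p+2) ≡ 1 (mod 8); if m ≥ 3, C_d(ℚ₂) ≠ ∅ if and only if d ≡ 1 (mod 4) or d − Dp ≡ 0 (mod 4). -/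
/-- A biquadratic integer polynomial with odd middle coefficient that vanishes at `1` modulo `8`
has a root in `ℤ_[2]`. -/
theorem PadicInt.exists_biquadratic_root (a b c : ℤ) (hb : Odd b) (h : 8 ∣ a + b + c) :
    ∃ x : ℤ_[2], (a : ℤ_[2]) * x ^ 4 + b * x ^ 2 + c = 0 := by
  let F : Polynomial ℤ_[2] := .C (a : ℤ_[2]) * .X ^ 4 + .C (b : ℤ_[2]) * .X ^ 2 + .C (c : ℤ_[2])
  have hF (x : ℤ_[2]) : F.aeval x = (a : ℤ_[2]) * x ^ 4 + b * x ^ 2 + c := by simp [F]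
  have hF1 : F.aeval (1 : ℤ_[2]) = ((a + b + c : ℤ) : ℤ_[2]) := by rw [hF]; push_cast; ring
  have hF1' : F.derivative.aeval (1 : ℤ_[2]) = ((2 * (2 * a + b) : ℤ) : ℤ_[2]) := by
    simp [F]; ring
  have hn1 : ‖((a + b + c : ℤ) : ℤ_[2])‖ ≤ (2 : ℝ) ^ (-(3 : ℕ) : ℤ) := by
    simpa using (PadicInt.norm_int_le_pow_iff_dvd (p := 2) (k := a + b + c) (n := 3)).2
      (by simpa using h)
  have hn2 : ¬ ‖((2 * (2 * a + b) : ℤ) : ℤ_[2])‖ ≤ (2 : ℝ) ^ (-(2 : ℕ) : ℤ) := by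
    intro hle
    have := (PadicInt.norm_int_le_pow_iff_dvd (p := 2) (k := 2 * (2 * a + b)) (n := 2)).1
      (by simpa using hle)
    obtain ⟨j, rfl⟩ := hb
    norm_num at this
    omega
  have hn3 : (2 : ℝ) ^ (-1 : ℤ) ≤ ‖((2 * (2 * a + b) : ℤ) : ℤ_[2])‖ := by
    by_contra! hlt
    refine hn2 ?_
    have := (PadicInt.norm_le_pow_iff_norm_lt_pow_add_one
      ((2 * (2 * a + b) : ℤ) : ℤ_[2]) (-2)).2 (by simpa using hlt)
    simpa using this
  obtain ⟨x, hx, -⟩ := hensels_lemma (F := F) (a := (1 : ℤ_[2])) (by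
    rw [hF1, hF1']
    norm_num at hn1 hn3 ⊢
    nlinarith)
  exact ⟨x, by rw [← hF, hx]⟩

theorem PadicInt.exists_sq_eq_intCast (n : ℤ) (h : n ≡ 1 [ZMOD 8]) :
    ∃ x : ℤ_[2], x ^ 2 = n := by
  obtain ⟨x, hx⟩ := PadicInt.exists_biquadratic_root 0 1 (-n) (by decide) (by
    have := h.dvd; omega)
  exact ⟨x, by push_cast at hx; linear_combination hx⟩

theorem PadicInt.two_pow_dvd_intCast {k : ℕ} {n : ℤ} (h : (2 : ℤ_[2]) ^ k ∣ n) :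
    (2 : ℤ) ^ k ∣ n := by
  have := (PadicInt.norm_int_le_pow_iff_dvd (p := 2) (k := n) (n := k)).1
    ((PadicInt.norm_le_pow_iff_mem_span_pow _ _).2 (Ideal.mem_span_singleton.2 (by simpa using h)))
  simpa using this

theorem PadicInt.eq_two_mul_or_eq_two_mul_add_one (x : ℤ_[2]) :
    ∃ y, x = 2 * y ∨ x = 2 * y + 1 := by
  obtain ⟨n, hn, hx⟩ := PadicInt.exists_mem_range x
  rw [PadicInt.maximalIdeal_eq_span_p, Ideal.mem_span_singleton] at hx
  obtain ⟨y, hy⟩ := hx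
  refine ⟨y, ?_⟩
  interval_cases n
  · left; push_cast at hy; linear_combination hy
  · right; push_cast at hy; linear_combination hy

theorem PadicInt.even_or_sq_eq (x : ℤ_[2]) : (∃ y, x = 2 * y) ∨ ∃ s, x ^ 2 = 1 + 8 * s := by
  obtain ⟨y, rfl | rfl⟩ := x.eq_two_mul_or_eq_two_mul_add_one
  · exact .inl ⟨y, rfl⟩
  · right
    obtain ⟨z, rfl | rfl⟩ := y.eq_two_mul_or_eq_two_mul_add_one
    · exact ⟨z * (2 * z + 1), by ring⟩
    · exact ⟨(2 * z + 1) * (z + 1), by ring⟩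

theorem PadicInt.mul_sq_eq_add_four_mul {d n : ℤ} {w X : ℤ_[2]} (h : d * w ^ 2 = n + 4 * X) :
    (4 ∣ n ∧ ∃ y, w = 2 * y) ∨ 4 ∣ d - n := by
  obtain ⟨y, rfl⟩ | ⟨s, hs⟩ := w.even_or_sq_eq
  · refine .inl ⟨?_, y, rfl⟩
    have := PadicInt.two_pow_dvd_intCast (k := 2) (n := n)
      ⟨d * y ^ 2 - X, by linear_combination -h⟩
    simpa using this
  · right
    have := PadicInt.two_pow_dvd_intCast (k := 2) (n := d - n)
      ⟨X - 2 * d * s, by push_cast; linear_combination h - d * hs⟩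
    simpa using this

theorem PadicInt.mul_sq_eq_odd_add_eight_mul {d n : ℤ} (hn : Odd n) {w X : ℤ_[2]}
    (h : d * w ^ 2 = n + 8 * X) : 8 ∣ d - n := by
  obtain ⟨y, rfl⟩ | ⟨s, hs⟩ := w.even_or_sq_eq
  · have := PadicInt.two_pow_dvd_intCast (k := 2) (n := n)
      ⟨d * y ^ 2 - 2 * X, by linear_combination -h⟩
    obtain ⟨j, rfl⟩ := hn
    norm_num at this
    omega
  · have := PadicInt.two_pow_dvd_intCast (k := 3) (n := d - n)
      ⟨X - d * s, by push_cast; linear_combination h - d * hs⟩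
    simpa using this

theorem PadicInt.even_of_mul_sq_eq_four_mul {d : ℤ} (hd : Odd d) {w X : ℤ_[2]}
    (h : d * w ^ 2 = 4 * X) : ∃ y, w = 2 * y := by
  rw [Int.odd_iff] at hd
  obtain h | h := PadicInt.mul_sq_eq_add_four_mul (d := d) (n := 0) (X := X) (by simpa using h)
  · exact h.2
  · omega

theorem Int.exists_sq_eq_one_add_eight_mul {d : ℤ} (hd : Odd d) : ∃ j, d ^ 2 = 1 + 8 * j := by
  obtain ⟨j, hj⟩ := Int.eight_dvd_sq_sub_one_of_odd hd
  exact ⟨j, by linarith⟩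

/-- If `d ≡ 3 [ZMOD 4]` and `B ≡ 1 [ZMOD 4]` then `d w² = 4 A u⁴ + B u² + 4ᵏ D²` has no solution
in `ℤ_[2]`. -/
theorem PadicInt.not_mul_sq_eq_biquadratic {d B D : ℤ} (hd : d % 4 = 3) (hB : B % 4 = 1)
    (hD : Odd D) (k : ℕ) (A u w : ℤ_[2])
    (h : d * w ^ 2 = 4 * A * u ^ 4 + B * u ^ 2 + 4 ^ k * D ^ 2) : False := by
  obtain ⟨j, hj⟩ := Int.exists_sq_eq_one_add_eight_mul hD
  have hj' : (D : ℤ_[2]) ^ 2 = 1 + 8 * j := by exact_mod_cast hj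
  induction k generalizing A u w with
  | zero =>
    obtain ⟨y, rfl⟩ | ⟨s, hs⟩ := u.even_or_sq_eq
    · have := PadicInt.mul_sq_eq_add_four_mul (d := d) (w := w) (n := 1)
        (X := 16 * A * y ^ 4 + B * y ^ 2 + 2 * j) (by
          push_cast; linear_combination h + hj')
      omega
    · have := PadicInt.mul_sq_eq_add_four_mul (d := d) (w := w) (n := B + 1)
        (X := A * u ^ 4 + B * 2 * s + 2 * j) (by
          push_cast; linear_combination h + hj' + B * hs)
      omega
  | succ k ih =>
    obtain ⟨y, rfl⟩ | ⟨s, hs⟩ := u.even_or_sq_eq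
    · obtain ⟨v, rfl⟩ := PadicInt.even_of_mul_sq_eq_four_mul (d := d) (w := w)
        (X := 16 * A * y ^ 4 + B * y ^ 2 + 4 ^ k * D ^ 2)
        (Int.odd_iff.2 (by omega)) (by linear_combination h)
      refine ih (4 * A) y v (mul_left_cancel₀ (by norm_num : (4 : ℤ_[2]) ≠ 0) ?_)
      linear_combination h
    · have := PadicInt.mul_sq_eq_add_four_mul (d := d) (w := w) (n := B)
        (X := A * u ^ 4 + B * 2 * s + 4 ^ k * D ^ 2) (by
          linear_combination h + B * hs)
      omega

theorem Padic.norm_intCast_of_odd {d : ℤ} (hd : Odd d) : ‖(d : ℚ_[2])‖ = 1 := by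
  refine le_antisymm (Padic.norm_int_le_one d) (not_lt.1 fun h ↦ ?_)
  rw [Padic.norm_intCast_lt_one_iff] at h
  rw [Int.odd_iff] at hd
  push_cast at h
  omega

theorem Padic.norm_le_one_of_mul_sq_eq {d : ℤ} (hd : Odd d) {w : ℚ_[2]} {r : ℤ_[2]}
    (h : d * w ^ 2 = (r : ℚ_[2])) : ‖w‖ ≤ 1 := by
  have := congrArg norm h
  rw [norm_mul, Padic.norm_intCast_of_odd hd, one_mul, norm_pow] at this
  exact (sq_le_one_iff₀ (norm_nonneg _)).1 (this ▸ PadicInt.norm_le_one r)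

/-- A homogeneous quartic `d w² = a u⁴ + b u² z² + c z⁴` with integral coefficients and `d` odd
that has a point over `ℚ_[2]` has one over `ℤ_[2]` with `u = 1` or `z = 1`. -/
theorem PadicInt.exists_normalized_point {a b c d : ℤ} (hd : Odd d) {u z w : ℚ_[2]}
    (h0 : ¬(u = 0 ∧ z = 0)) (h : d * w ^ 2 = a * u ^ 4 + b * u ^ 2 * z ^ 2 + c * z ^ 4) :
    (∃ z w : ℤ_[2], d * w ^ 2 = a + b * z ^ 2 + c * z ^ 4) ∨
      ∃ u w : ℤ_[2], d * w ^ 2 = a * u ^ 4 + b * u ^ 2 + c := by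
  rcases le_total ‖u‖ ‖z‖ with hle | hle
  · right
    have hz : z ≠ 0 := by
      rintro rfl
      exact h0 ⟨by simpa using hle, rfl⟩
    let x : ℤ_[2] := ⟨u / z, by
      rw [norm_div]; exact div_le_one_of_le₀ hle (norm_nonneg _)⟩
    have hx : (x : ℚ_[2]) = u / z := rfl
    have key : (d : ℚ_[2]) * (w / z ^ 2) ^ 2 =
        ((a * x ^ 4 + b * x ^ 2 + c : ℤ_[2]) : ℚ_[2]) := by
      push_cast
      rw [hx]
      field_simp
      linear_combination h
    obtain ⟨y, hy⟩ : ∃ y : ℤ_[2], (y : ℚ_[2]) = w / z ^ 2 :=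
      ⟨⟨_, Padic.norm_le_one_of_mul_sq_eq hd key⟩, rfl⟩
    rw [← hy] at key
    exact ⟨x, y, Subtype.coe_injective (by push_cast at key ⊢; exact key)⟩
  · left
    have hu : u ≠ 0 := by
      rintro rfl
      exact h0 ⟨rfl, by simpa using hle⟩
    let x : ℤ_[2] := ⟨z / u, by
      rw [norm_div]; exact div_le_one_of_le₀ hle (norm_nonneg _)⟩
    have hx : (x : ℚ_[2]) = z / u := rfl
    have key : (d : ℚ_[2]) * (w / u ^ 2) ^ 2 =
        ((a + b * x ^ 2 + c * x ^ 4 : ℤ_[2]) : ℚ_[2]) := by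
      push_cast
      rw [hx]
      field_simp
      linear_combination h
    obtain ⟨y, hy⟩ : ∃ y : ℤ_[2], (y : ℚ_[2]) = w / u ^ 2 :=
      ⟨⟨_, Padic.norm_le_one_of_mul_sq_eq hd key⟩, rfl⟩
    rw [← hy] at key
    exact ⟨x, y, Subtype.coe_injective (by push_cast at key ⊢; exact key)⟩

section

variable {k : ℕ} {p q t D d : ℤ}

theorem cdPoints_iff (hsum : p + q = 2 * t) (hd : Odd d) :
    CdPoints ℚ_[2] (k + 1) p q D d ↔
      (∃ z w : ℤ_[2], d * w ^ 2 = d ^ 2 - 4 * t * D * d * z ^ 2 + 4 ^ (k + 1) * D ^ 2 * z ^ 4) ∨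
      ∃ u w : ℤ_[2], d * w ^ 2 = d ^ 2 * u ^ 4 - 4 * t * D * d * u ^ 2 + 4 ^ (k + 1) * D ^ 2 := by
  have hs : (p : ℚ_[2]) + q = 2 * t := by exact_mod_cast hsum
  have h4 : ((4 : ℤ_[2]) : ℚ_[2]) = 4 := map_ofNat PadicInt.Coe.ringHom 4
  constructor
  · rintro ⟨u, z, w, h0, h⟩
    have := PadicInt.exists_normalized_point (a := d ^ 2) (b := -4 * t * D * d)
      (c := 4 ^ (k + 1) * D ^ 2) hd h0 (by
        push_cast
        rw [h, hs]
        ring)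
    push_cast at this
    simpa [sub_eq_add_neg] using this
  · rintro (⟨z, w, h⟩ | ⟨u, w, h⟩)
    · refine ⟨1, z, w, by simp, ?_⟩
      have := congrArg (fun x : ℤ_[2] ↦ (x : ℚ_[2])) h
      push_cast at this
      rw [h4] at this
      rw [hs]
      linear_combination this
    · refine ⟨u, 1, w, by simp, ?_⟩
      have := congrArg (fun x : ℤ_[2] ↦ (x : ℚ_[2])) h
      push_cast at this
      rw [h4] at this
      rw [hs]
      linear_combination this

/-- An integral value `N` of the quartic at `z = 1` with `d N ≡ 1 [ZMOD 8]` up to a square factor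
`r²` gives a point. -/
theorem cdPoints_of_modEq (hsum : p + q = 2 * t) {N r : ℤ} {u : ℤ} (hd : Odd d)
    (hN : d ^ 2 * u ^ 4 - 4 * t * D * d * u ^ 2 + 4 ^ (k + 1) * D ^ 2 = r ^ 2 * N)
    (h : d * N ≡ 1 [ZMOD 8]) : CdPoints ℚ_[2] (k + 1) p q D d := by
  obtain ⟨y, hy⟩ := PadicInt.exists_sq_eq_intCast _ h
  have hs : (p : ℚ_[2]) + q = 2 * t := by exact_mod_cast hsum
  have hd0 : (d : ℚ_[2]) ≠ 0 := by
    norm_cast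
    rintro rfl
    exact absurd hd (by decide)
  refine ⟨u, 1, r * y / d, by simp, ?_⟩
  have hy' := congrArg (fun x : ℤ_[2] ↦ (x : ℚ_[2])) hy
  have hN' := congrArg (fun x : ℤ ↦ (x : ℚ_[2])) hN
  push_cast at hy' hN'
  rw [hs, div_pow, mul_pow, hy']
  field_simp
  linear_combination -hN'

theorem cdPoints_of_modEq_one (hsum : p + q = 2 * t) (hD : Odd D)
    (hk : k = 0 ∧ Even t ∨ 1 ≤ k ∧ Odd t) (h : d ≡ 1 [ZMOD 4]) :
    CdPoints ℚ_[2] (k + 1) p q D d := by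
  have hd : Odd d := Int.odd_iff.2 (by have := h.dvd; omega)
  have h8 : d ≡ 1 [ZMOD 8] ∨ d ≡ 5 [ZMOD 8] := by
    simp only [Int.ModEq] at h ⊢
    omega
  rcases h8 with h8 | h8
  · obtain ⟨y, hy⟩ := PadicInt.exists_sq_eq_intCast d h8
    have hy' := congrArg (fun x : ℤ_[2] ↦ (x : ℚ_[2])) hy
    push_cast at hy'
    exact ⟨1, 0, y, by simp, by rw [hy']; ring⟩
  · have hodd : Odd (t * D * d - 4 ^ k * D ^ 2) := by
      rcases hk with ⟨rfl, ht⟩ | ⟨hk, ht⟩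
      · simpa using ((ht.mul_right D).mul_right d).sub_odd hD.pow
      · exact ((ht.mul hD).mul hd).sub_even
          ((Even.pow_of_ne_zero (by decide) (by omega)).mul_right _)
    obtain ⟨j, hj⟩ := hodd
    obtain ⟨i, hi⟩ := Int.exists_sq_eq_one_add_eight_mul hd
    refine cdPoints_of_modEq (u := 1) (r := 1) (N := 5 + 8 * (i - j - 1)) hsum hd
      (by linear_combination hi - 4 * hj) ?_
    calc d * (5 + 8 * (i - j - 1)) ≡ 5 * 5 [ZMOD 8] := h8.mul (by simp [Int.ModEq])
      _ ≡ 1 [ZMOD 8] := by decide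

theorem modEq_one_or_exists_of_cdPoints (hsum : p + q = 2 * t) (hd : Odd d)
    (h : CdPoints ℚ_[2] (k + 1) p q D d) :
    d ≡ 1 [ZMOD 4] ∨
      ∃ u w : ℤ_[2], d * w ^ 2 = 4 * (d ^ 2 * u ^ 4 - t * D * d * u ^ 2) + 4 ^ k * D ^ 2 := by
  obtain ⟨i, hi⟩ := Int.exists_sq_eq_one_add_eight_mul hd
  have hi' : (d : ℤ_[2]) ^ 2 = 1 + 8 * i := by exact_mod_cast hi
  have key {w X : ℤ_[2]} (h : d * w ^ 2 = 1 + 4 * X) : d ≡ 1 [ZMOD 4] := by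
    have := PadicInt.mul_sq_eq_add_four_mul (n := 1) (X := X) (by simpa using h)
    exact (Int.modEq_iff_dvd.2 (by omega)).symm
  rcases (cdPoints_iff hsum hd).1 h with ⟨z, w, h⟩ | ⟨u, w, h⟩
  · left
    refine key (w := w) (X := 2 * i - t * D * d * z ^ 2 + 4 ^ k * D ^ 2 * z ^ 4) ?_
    linear_combination h + hi'
  · obtain ⟨y, rfl⟩ | ⟨s, hs⟩ := u.even_or_sq_eq
    · right
      obtain ⟨v, rfl⟩ := PadicInt.even_of_mul_sq_eq_four_mul (d := d) (w := w)
        (X := 4 * (d ^ 2 * y ^ 4 - t * D * d * y ^ 2) + 4 ^ k * D ^ 2) hd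
        (by linear_combination h)
      refine ⟨y, v, mul_left_cancel₀ (by norm_num : (4 : ℤ_[2]) ≠ 0) ?_⟩
      linear_combination h
    · left
      refine key (w := w)
        (X := 2 * i + d ^ 2 * (4 * s + 16 * s ^ 2) - t * D * d * u ^ 2 + 4 ^ k * D ^ 2) ?_
      linear_combination h + hi' + d ^ 2 * (u ^ 2 + 1 + 8 * s) * hs

theorem cdPoints_one_iff (hsum : p + q = 2 * t) (ht : Even t) (hd : Odd d) (hD : Odd D) :
    CdPoints ℚ_[2] 1 p q D d ↔ d ≡ 1 [ZMOD 4] := by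
  refine ⟨fun h ↦ ?_, cdPoints_of_modEq_one hsum hD (.inl ⟨rfl, ht⟩)⟩
  obtain h | ⟨u, w, h⟩ := modEq_one_or_exists_of_cdPoints (k := 0) hsum hd h
  · exact h
  obtain ⟨j, hj⟩ := Int.exists_sq_eq_one_add_eight_mul hD
  have hj' : (D : ℤ_[2]) ^ 2 = 1 + 8 * j := by exact_mod_cast hj
  have := PadicInt.mul_sq_eq_add_four_mul (d := d) (w := w) (n := 1)
    (X := d ^ 2 * u ^ 4 - t * D * d * u ^ 2 + 2 * j) (by
      push_cast; linear_combination h + hj')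
  exact (Int.modEq_iff_dvd.2 (by omega)).symm

theorem modEq_one_or_exists_of_cdPoints_add_two (hsum : p + q = 2 * t) (hd : Odd d)
    (h : CdPoints ℚ_[2] (k + 2) p q D d) :
    d ≡ 1 [ZMOD 4] ∨
      ∃ u w : ℤ_[2], d * w ^ 2 = d ^ 2 * u ^ 4 - t * D * d * u ^ 2 + 4 ^ k * D ^ 2 := by
  refine (modEq_one_or_exists_of_cdPoints (k := k + 1) hsum hd h).imp_right ?_
  rintro ⟨u, w, h⟩
  obtain ⟨v, rfl⟩ := PadicInt.even_of_mul_sq_eq_four_mul (d := d) (w := w)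
    (X := d ^ 2 * u ^ 4 - t * D * d * u ^ 2 + 4 ^ k * D ^ 2) hd (by linear_combination h)
  refine ⟨u, v, mul_left_cancel₀ (by norm_num : (4 : ℤ_[2]) ≠ 0) ?_⟩
  linear_combination h

theorem cdPoints_two_iff (hsum : p + q = 2 * t) (ht : Odd t) (hd : Odd d) (hD : Odd D) :
    CdPoints ℚ_[2] 2 p q D d ↔ d ≡ 1 [ZMOD 4] ∨ 2 * d - D * t ≡ 1 [ZMOD 8] := by
  obtain ⟨i, hi⟩ := Int.exists_sq_eq_one_add_eight_mul hd
  obtain ⟨j, hj⟩ := Int.exists_sq_eq_one_add_eight_mul hD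
  have hi' : (d : ℤ_[2]) ^ 2 = 1 + 8 * i := by exact_mod_cast hi
  have hj' : (D : ℤ_[2]) ^ 2 = 1 + 8 * j := by exact_mod_cast hj
  constructor
  · intro h
    obtain h | ⟨u, w, h⟩ := modEq_one_or_exists_of_cdPoints_add_two (k := 0) hsum hd h
    · exact .inl h
    obtain ⟨y, rfl⟩ | ⟨s, hs⟩ := u.even_or_sq_eq
    · left
      have := PadicInt.mul_sq_eq_add_four_mul (d := d) (w := w) (n := 1)
        (X := 4 * d ^ 2 * y ^ 4 - t * D * d * y ^ 2 + 2 * j) (by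
          push_cast; linear_combination h + hj')
      exact (Int.modEq_iff_dvd.2 (by omega)).symm
    · right
      have hn : Odd (2 - t * D * d) := even_two.sub_odd ((ht.mul hD).mul hd)
      obtain ⟨l, hl⟩ := PadicInt.mul_sq_eq_odd_add_eight_mul (d := d) (w := w) hn
        (X := i + d ^ 2 * (2 * s + 8 * s ^ 2) - t * D * d * s + j) (by
          push_cast
          linear_combination h + hi' + hj' + (d ^ 2 * (u ^ 2 + 1 + 8 * s) - t * D * d) * hs)
      refine (Int.modEq_iff_dvd.2 ⟨i + D * t * i - d * l, ?_⟩).symm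
      linear_combination (1 + D * t) * hi - d * hl
  · rintro (h | h)
    · exact cdPoints_of_modEq_one (k := 1) hsum hD (.inr ⟨le_rfl, ht⟩) h
    · refine cdPoints_of_modEq (k := 1) (u := 2) (r := 4)
        (N := d ^ 2 - t * D * d + D ^ 2) hsum hd (by ring) ?_
      refine Int.ModEq.trans (Int.modEq_iff_dvd.2 ⟨D * t * i - d * i - d * j, ?_⟩) h
      linear_combination (D * t - d) * hi - d * hj

theorem cdPoints_add_three_iff (hsum : p + q = 2 * t) (ht : Odd t) (hd : Odd d) (hD : Odd D) :
    CdPoints ℚ_[2] (k + 3) p q D d ↔ d ≡ 1 [ZMOD 4] ∨ d ≡ D * t [ZMOD 4] := by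
  obtain ⟨i, hi⟩ := Int.exists_sq_eq_one_add_eight_mul hd
  have hi' : (d : ℤ_[2]) ^ 2 = 1 + 8 * i := by exact_mod_cast hi
  have hDt := Int.odd_iff.1 (hD.mul ht)
  have hd2 := Int.odd_iff.1 hd
  constructor
  · intro h
    obtain h | ⟨u, w, h⟩ := modEq_one_or_exists_of_cdPoints_add_two (k := k + 1) hsum hd h
    · exact .inl h
    by_contra! hne
    have hd3 : d % 4 = 3 := by
      have := hne.1
      simp only [Int.ModEq] at this
      omega
    have hB : -(t * D * d) % 4 = 1 := by
      have : D * t % 4 = 1 := by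
        have := hne.2
        simp only [Int.ModEq] at this
        omega
      rw [mul_comm t D, Int.neg_emod_eq_sub_emod, Int.sub_emod, Int.mul_emod, this, hd3]
      rfl
    obtain ⟨y, rfl⟩ | ⟨s, hs⟩ := u.even_or_sq_eq
    · obtain ⟨v, rfl⟩ := PadicInt.even_of_mul_sq_eq_four_mul (d := d) (w := w)
        (X := 4 * d ^ 2 * y ^ 4 - t * D * d * y ^ 2 + 4 ^ k * D ^ 2) hd
        (by linear_combination h)
      refine PadicInt.not_mul_sq_eq_biquadratic hd3 hB hD k (d ^ 2) y v
        (mul_left_cancel₀ (by norm_num : (4 : ℤ_[2]) ≠ 0) ?_)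
      push_cast
      linear_combination h
    · have := PadicInt.mul_sq_eq_add_four_mul (d := d) (w := w) (n := 1 + -(t * D * d))
        (X := 2 * i + d ^ 2 * (4 * s + 16 * s ^ 2) - 2 * t * D * d * s + 4 ^ k * D ^ 2) (by
          push_cast
          linear_combination h + hi' + (d ^ 2 * (u ^ 2 + 1 + 8 * s) - t * D * d) * hs)
      generalize t * D * d = B at this hB
      omega
  · rintro (h | h)
    · exact cdPoints_of_modEq_one (k := k + 2) hsum hD (.inr ⟨by omega, ht⟩) h
    · have h1 : D * t * d ≡ 1 [ZMOD 4] := by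
        refine (h.symm.mul_right d).trans (Int.modEq_iff_dvd.2 ⟨-2 * i, ?_⟩)
        linear_combination -hi
      obtain ⟨c, hc⟩ : ∃ c : ℤ,
          8 ∣ d ^ 2 + -(D * t * d + 4 * d ^ 3 * c ^ 2) + 4 ^ (k + 1) * D ^ 2 := by
        obtain ⟨a, ha⟩ : 4 ∣ d ^ 2 - D * t * d + 4 ^ (k + 1) * D ^ 2 := by
          obtain ⟨r, hr⟩ := h1.symm.dvd
          exact ⟨2 * i - r + 4 ^ k * D ^ 2, by linear_combination hi - hr⟩
        obtain ⟨b, rfl | rfl⟩ := a.even_or_odd'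
        · exact ⟨0, b, by linear_combination ha⟩
        · obtain ⟨r, hr⟩ := hd.pow (n := 3)
          exact ⟨1, b - r, by linear_combination ha - 4 * hr⟩
      obtain ⟨x, hx⟩ := PadicInt.exists_biquadratic_root (d ^ 2) (-(D * t * d + 4 * d ^ 3 * c ^ 2))
        (4 ^ (k + 1) * D ^ 2) (by
          rw [odd_neg]
          exact ((hD.mul ht).mul hd).add_even ⟨2 * d ^ 3 * c ^ 2, by ring⟩) hc
      refine (cdPoints_iff (k := k + 2) hsum hd).2 (.inr ⟨2 * x, 8 * d * c * x, ?_⟩)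
      push_cast at hx
      linear_combination -16 * hx

end

theorem stmt8
    (m : ℕ) (hm : 1 ≤ m)
    (p q : ℕ) (hp : p.Prime) (hq : q.Prime) (hpodd : Odd p) (hqodd : Odd q)
    (hpq : (q : ℤ) - (p : ℤ) = 2 ^ m)
    (D : ℤ) (hD0 : 0 < D) (hDsf : Squarefree D) (hDodd : Odd D)
    (hpD : ¬((p : ℤ) ∣ D)) (hqD : ¬((q : ℤ) ∣ D))
    (d : ℤ) (hd0 : 0 < d) (hdD : d ∣ D) :
    (m = 1 → (CdPoints ℚ_[2] m (p : ℤ) (q : ℤ) D d ↔ d ≡ 1 [ZMOD 4])) ∧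
    (m = 2 → (CdPoints ℚ_[2] m (p : ℤ) (q : ℤ) D d ↔
      (d ≡ 1 [ZMOD 4] ∨ 2 * d - D * ((p : ℤ) + 2) ≡ 1 [ZMOD 8]))) ∧
    (3 ≤ m → (CdPoints ℚ_[2] m (p : ℤ) (q : ℤ) D d ↔
      (d ≡ 1 [ZMOD 4] ∨ d - D * (p : ℤ) ≡ 0 [ZMOD 4]))) := by
  have hd : Odd d := hdD.elim fun e he ↦ Int.Odd.of_mul_left (he ▸ hDodd)
  have hsum {k : ℕ} (hk : m = k + 1) : (p : ℤ) + q = 2 * (p + 2 ^ k) := by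
    rw [hk, pow_succ] at hpq
    linear_combination hpq
  have hpodd' : Odd (p : ℤ) := by exact_mod_cast hpodd
  have hodd {k : ℕ} : Odd ((p : ℤ) + 2 ^ (k + 1)) :=
    hpodd'.add_even (by simp [parity_simps])
  refine ⟨?_, ?_, fun h3 ↦ ?_⟩
  · rintro rfl
    exact cdPoints_one_iff (hsum rfl) hpodd'.add_one hd hDodd
  · rintro rfl
    exact cdPoints_two_iff (hsum rfl) (hodd (k := 0)) hd hDodd
  · obtain ⟨k, rfl⟩ := Nat.exists_eq_add_of_le' h3
    rw [cdPoints_add_three_iff (hsum rfl) hodd hd hDodd]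
    refine or_congr_right ?_
    have : D * ((p : ℤ) + 2 ^ (k + 2)) = D * p + 4 * (D * 2 ^ k) := by ring
    rw [this]
    simp only [Int.ModEq]
    omega
end

section
/- Let ε = 1 and let d be a positive integer with d ∣ D. For every prime l dividing pqD/d, one has C_d(ℚ_l) ≠ ∅ if and only if the Legendre symbol (d/l) equals 1. -/
/-- Hensel's lemma for square roots: an integer that is a nonzero square modulo an odd prime `l`
is a square in `ℚ_[l]`. -/
theorem Padic.exists_sq_eq_of_isSquare_zmod {l : ℕ} [Fact l.Prime] (hl2 : l ≠ 2) {d : ℤ}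
    (hld : ¬(l : ℤ) ∣ d) (h : IsSquare (d : ZMod l)) : ∃ s : ℚ_[l], s ^ 2 = d := by
  obtain ⟨r, hr⟩ := h
  obtain ⟨a, rfl⟩ := ZMod.intCast_surjective r
  have hda : (l : ℤ) ∣ a ^ 2 - d := by
    rw [← ZMod.intCast_zmod_eq_zero_iff_dvd]
    push_cast
    rw [hr]
    ring
  have hla : ¬(l : ℤ) ∣ 2 * a := by
    have hprime : Prime (l : ℤ) := Nat.prime_iff_prime_int.mp Fact.out
    intro h2a
    rcases hprime.dvd_or_dvd h2a with h2 | ha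
    · exact hl2 ((Nat.prime_dvd_prime_iff_eq Fact.out Nat.prime_two).mp (by exact_mod_cast h2))
    · exact hld ((dvd_sub_right (dvd_pow ha two_ne_zero)).mp hda)
  have hnorm : ‖(2 * a : ℤ_[l])‖ = 1 := by
    have h1 := (PadicInt.norm_int_lt_one_iff_dvd (p := l) (2 * a)).not.mpr hla
    push_cast at h1
    exact le_antisymm (PadicInt.norm_le_one _) (not_lt.mp h1)
  have hsmall : ‖(a ^ 2 - d : ℤ_[l])‖ < 1 := by
    have h1 := (PadicInt.norm_int_lt_one_iff_dvd (p := l) (a ^ 2 - d)).mpr hda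
    push_cast at h1
    exact h1
  obtain ⟨z, hz, -⟩ := hensels_lemma (p := l) (R := ℤ_[l])
    (F := Polynomial.X ^ 2 - Polynomial.C (d : ℤ_[l])) (a := (a : ℤ_[l])) (by
      simpa [hnorm, one_add_one_eq_two] using hsmall)
  refine ⟨z, ?_⟩
  have hz' : z ^ 2 = (d : ℤ_[l]) := by simpa [sub_eq_zero] using hz
  exact_mod_cast congrArg (fun x : ℤ_[l] => (x : ℚ_[l])) hz'

theorem Padic.norm_intCast_eq_one {l : ℕ} [Fact l.Prime] {d : ℤ} (hld : ¬(l : ℤ) ∣ d) :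
    ‖(d : ℚ_[l])‖ = 1 :=
  le_antisymm (Padic.norm_int_le_one d)
    (not_lt.mp (Padic.norm_intCast_lt_one_iff.not.mpr hld))

/-- If `d` is an `l`-adic unit and the form `x² - d y²` takes a value smaller than its first term,
then `d` is a square modulo `l`. -/
theorem Padic.isSquare_zmod_of_norm_sq_sub_lt {l : ℕ} [Fact l.Prime] {d : ℤ}
    (hld : ¬(l : ℤ) ∣ d) {x y : ℚ_[l]} (h : ‖x ^ 2 - d * y ^ 2‖ < ‖x‖ ^ 2) :
    IsSquare (d : ZMod l) := by
  have hx : x ≠ 0 := by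
    rintro rfl
    simp only [norm_zero, ne_eq, OfNat.ofNat_ne_zero, not_false_eq_true, zero_pow] at h
    exact absurd h (not_lt.mpr (norm_nonneg _))
  have ht : ‖1 - d * (y / x) ^ 2‖ < 1 := by
    have heq : x ^ 2 - d * y ^ 2 = x ^ 2 * (1 - d * (y / x) ^ 2) := by field_simp
    rw [heq, norm_mul, norm_pow] at h
    exact (mul_lt_iff_lt_one_right (by positivity)).mp h
  have hle : ‖y / x‖ ≤ 1 := by
    have h1 : ‖(d : ℚ_[l]) * (y / x) ^ 2‖ ≤ 1 := by
      have := Padic.nonarchimedean (1 : ℚ_[l]) (-(1 - d * (y / x) ^ 2))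
      rw [norm_neg, norm_one, max_eq_left ht.le] at this
      simpa using this
    rw [norm_mul, norm_intCast_eq_one hld, one_mul, norm_pow] at h1
    exact (sq_le_one_iff₀ (norm_nonneg _)).mp h1
  obtain ⟨t, hxt⟩ : ∃ t : ℤ_[l], (t : ℚ_[l]) = y / x := ⟨⟨y / x, hle⟩, rfl⟩
  have hmem : 1 - d * t ^ 2 ∈ RingHom.ker (PadicInt.toZMod : ℤ_[l] →+* ZMod l) := by
    rw [PadicInt.ker_toZMod, PadicInt.maximalIdeal_eq_span_p, Ideal.mem_span_singleton,
      ← PadicInt.norm_lt_one_iff_dvd, PadicInt.norm_def]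
    push_cast
    rwa [hxt]
  simp only [RingHom.mem_ker, map_sub, map_one, map_mul, map_pow, map_intCast, sub_eq_zero] at hmem
  generalize PadicInt.toZMod t = c at hmem
  have hc : c ≠ 0 := by
    intro hc
    simp [hc] at hmem
  refine ⟨c⁻¹, ?_⟩
  field_simp
  exact hmem.symm

/-- An element of `ℚ_[l]` of odd valuation is never as large as a square. -/
theorem Padic.norm_sq_ne_inv_mul_norm_sq {l : ℕ} [Fact l.Prime] (a : ℚ_[l]) {b : ℚ_[l]}
    (hb : b ≠ 0) : ‖a‖ ^ 2 ≠ (l : ℝ)⁻¹ * ‖b‖ ^ 2 := by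
  have hl : 1 < (l : ℝ) := by exact_mod_cast (Fact.out : l.Prime).one_lt
  have hl0 : (l : ℝ) ≠ 0 := by positivity
  have hb' : 0 < ‖b‖ := norm_pos_iff.mpr hb
  intro h
  have ha : a ≠ 0 := by
    rintro rfl
    have : 0 < (l : ℝ)⁻¹ * ‖b‖ ^ 2 := by positivity
    simp [← h] at this
  rw [norm_eq_zpow_neg_valuation ha, norm_eq_zpow_neg_valuation hb, ← zpow_neg_one,
    ← zpow_natCast, ← zpow_natCast, ← zpow_mul, ← zpow_mul, ← zpow_add₀ hl0] at h
  have := zpow_right_injective₀ (by positivity) hl.ne' h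
  push_cast at this
  omega

theorem Padic.norm_intCast_eq_inv {l : ℕ} [Fact l.Prime] {k : ℤ} (hk : ¬(l : ℤ) ∣ k) :
    ‖(l * k : ℚ_[l])‖ = (l : ℝ)⁻¹ := by
  rw [norm_mul, norm_intCast_eq_one hk, mul_one, Padic.norm_p]

/-- The equation `X² - d w² = N y²`, with `d` a unit and `N` a uniformizer, forces `d` to be a
square modulo `l`. -/
theorem Padic.isSquare_zmod_of_sq_sub_eq_uniformizer_mul_sq {l : ℕ} [Fact l.Prime] {d : ℤ}
    (hld : ¬(l : ℤ) ∣ d) {N x w y : ℚ_[l]} (hN : ‖N‖ = (l : ℝ)⁻¹) (hxy : x ≠ 0 ∨ y ≠ 0)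
    (h : x ^ 2 - d * w ^ 2 = N * y ^ 2) : IsSquare (d : ZMod l) := by
  have hnorm : ‖x ^ 2 - d * w ^ 2‖ = (l : ℝ)⁻¹ * ‖y‖ ^ 2 := by rw [h, norm_mul, hN, norm_pow]
  by_cases hy : y = 0
  · have hx : 0 < ‖x‖ := norm_pos_iff.mpr (hxy.resolve_right (not_not.mpr hy))
    refine isSquare_zmod_of_norm_sq_sub_lt hld (x := x) (y := w) ?_
    rw [hnorm, hy]
    simpa using pow_pos hx 2
  rcases lt_trichotomy (‖x‖ ^ 2) ((l : ℝ)⁻¹ * ‖y‖ ^ 2) with hlt | heq | hgt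
  · exfalso
    have hdw : (d : ℚ_[l]) * w ^ 2 = x ^ 2 + -(x ^ 2 - d * w ^ 2) := by ring
    have hw : ‖(d : ℚ_[l]) * w ^ 2‖ = (l : ℝ)⁻¹ * ‖y‖ ^ 2 := by
      rw [hdw, Padic.add_eq_max_of_ne, norm_neg, hnorm, norm_pow, max_eq_right hlt.le]
      rw [norm_neg, hnorm, norm_pow]
      exact hlt.ne
    rw [norm_mul, norm_intCast_eq_one hld, one_mul, norm_pow] at hw
    exact norm_sq_ne_inv_mul_norm_sq w hy hw
  · exact absurd heq (norm_sq_ne_inv_mul_norm_sq x hy)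
  · exact isSquare_zmod_of_norm_sq_sub_lt hld (hnorm.trans_lt hgt)

/-- If `d` times a square equals `a² + c a b + b²` with `c` integral and `‖a‖ ≠ ‖b‖`, then the
larger of `a`, `b` dominates and `d` is a square modulo `l`. -/
theorem Padic.isSquare_zmod_of_mul_sq_eq_quadratic {l : ℕ} [Fact l.Prime] {d : ℤ}
    (hld : ¬(l : ℤ) ∣ d) {a b c w : ℚ_[l]} (hc : ‖c‖ ≤ 1) (hab : ‖a‖ ≠ ‖b‖)
    (h : d * w ^ 2 = a ^ 2 + c * a * b + b ^ 2) : IsSquare (d : ZMod l) := by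
  wlog hlt : ‖b‖ < ‖a‖ generalizing a b
  · exact this hab.symm (by rw [h]; ring) (lt_of_le_of_ne (not_lt.mp hlt) hab)
  refine isSquare_zmod_of_norm_sq_sub_lt hld (x := a) (y := w) ?_
  have heq : a ^ 2 - d * w ^ 2 = -(b * (c * a + b)) := by rw [h]; ring
  have hsum : ‖c * a + b‖ ≤ ‖a‖ := by
    refine (Padic.nonarchimedean _ _).trans (max_le ?_ hlt.le)
    exact (norm_mul c a).trans_le (mul_le_of_le_one_left (norm_nonneg _) hc)
  rw [heq, norm_neg, norm_mul, sq]
  have ha : 0 < ‖a‖ := (norm_nonneg b).trans_lt hlt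
  exact (mul_le_mul_of_nonneg_left hsum (norm_nonneg b)).trans_lt (mul_lt_mul_of_pos_right hlt ha)

theorem stmt9
    (m : ℕ) (hm : 1 ≤ m)
    (p q : ℕ) (hp : p.Prime) (hq : q.Prime) (hpodd : Odd p) (hqodd : Odd q)
    (hpq : (q : ℤ) - (p : ℤ) = 2 ^ m)
    (D : ℤ) (hD0 : 0 < D) (hDsf : Squarefree D) (hDodd : Odd D)
    (hpD : ¬((p : ℤ) ∣ D)) (hqD : ¬((q : ℤ) ∣ D))
    (d : ℤ) (hd0 : 0 < d) (hdD : d ∣ D) :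
    ∀ l : ℕ, ∀ hl : l.Prime, (l : ℤ) ∣ (p : ℤ) * (q : ℤ) * D / d →
      (letI : Fact l.Prime := ⟨hl⟩;
        (CdPoints ℚ_[l] m (p : ℤ) (q : ℤ) D d ↔ legendreSym l d = 1)) := by
  intro l hl hdvd
  have : Fact l.Prime := ⟨hl⟩
  change CdPoints ℚ_[l] m (p : ℤ) (q : ℤ) D d ↔ legendreSym l d = 1
  obtain ⟨e, rfl⟩ := hdD
  have hdiv : (p : ℤ) * q * (d * e) / d = p * q * e := by
    rw [show (p : ℤ) * q * (d * e) = d * (p * q * e) by ring]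
    exact Int.mul_ediv_cancel_left _ hd0.ne'
  rw [hdiv] at hdvd
  have hlprime : Prime (l : ℤ) := Nat.prime_iff_prime_int.mp hl
  have hne : p ≠ q := by
    rintro rfl
    simp at hpq
    exact absurd hpq.symm (by positivity)
  have hcases : (l = p ∨ l = q) ∨ (l : ℤ) ∣ e := by
    rcases hlprime.dvd_or_dvd hdvd with h | h
    · rcases hlprime.dvd_or_dvd h with h | h
      · exact .inl (.inl ((Nat.prime_dvd_prime_iff_eq hl hp).mp (by exact_mod_cast h)))
      · exact .inl (.inr ((Nat.prime_dvd_prime_iff_eq hl hq).mp (by exact_mod_cast h)))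
    · exact .inr h
  have hl2 : ¬(l : ℤ) ∣ 2 := by
    intro h
    obtain rfl : l = 2 := (Nat.prime_dvd_prime_iff_eq hl Nat.prime_two).mp (by exact_mod_cast h)
    rcases hcases with (rfl | rfl) | h
    · exact absurd hpodd (by decide)
    · exact absurd hqodd (by decide)
    · exact absurd hDodd (Int.not_odd_iff_even.mpr (even_iff_two_dvd.mpr (h.mul_left d)))
  have hld : ¬(l : ℤ) ∣ d := by
    rcases hcases with (rfl | rfl) | h
    · exact fun h => hpD (h.mul_right e)
    · exact fun h => hqD (h.mul_right e)
    · exact fun h' => hlprime.not_isUnit (hDsf _ (mul_dvd_mul h' h))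
  have hdz : (d : ZMod l) ≠ 0 := by rwa [Ne, ZMod.intCast_zmod_eq_zero_iff_dvd]
  have hdQ : (d : ℚ_[l]) ≠ 0 := by exact_mod_cast hd0.ne'
  rw [legendreSym.eq_one_iff l hdz]
  constructor
  · rintro ⟨u, z, w, huz, h⟩
    push_cast at h
    rcases hcases with hlpq | ⟨k, rfl⟩
    · have hlD : ¬(l : ℤ) ∣ d * e := by rcases hlpq with rfl | rfl <;> assumption
      obtain ⟨r, hr, hrpq⟩ : ∃ r : ℤ, ¬(l : ℤ) ∣ r ∧ (p : ℤ) * q = l * r := by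
        rcases hlpq with rfl | rfl
        · exact ⟨q, fun h => hne ((Nat.prime_dvd_prime_iff_eq hl hq).mp (by exact_mod_cast h)),
            rfl⟩
        · exact ⟨p, fun h => hne ((Nat.prime_dvd_prime_iff_eq hl hp).mp (by exact_mod_cast h)).symm,
            mul_comm _ _⟩
      have hk : ¬(l : ℤ) ∣ 2 * 2 * r * ((d * e) * (d * e)) :=
        hlprime.not_dvd_mul
          (hlprime.not_dvd_mul (hlprime.not_dvd_mul hl2 hl2) hr) (hlprime.not_dvd_mul hlD hlD)
      have hrQ : (p : ℚ_[l]) * q = l * r := by exact_mod_cast congrArg (Int.cast : ℤ → ℚ_[l]) hrpq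
      have h4 : (4 : ℚ_[l]) ^ m = (q - p) ^ 2 := by
        have : (q : ℚ_[l]) - p = 2 ^ m := by exact_mod_cast congrArg (Int.cast : ℤ → ℚ_[l]) hpq
        rw [this, ← pow_mul, mul_comm m 2, pow_mul]
        norm_num
      refine Padic.isSquare_zmod_of_sq_sub_eq_uniformizer_mul_sq hld
        (x := d * u ^ 2 - (p + q) * (d * e) * z ^ 2) (w := w) (y := z ^ 2)
        (Padic.norm_intCast_eq_inv hk) ?_ ?_
      · by_cases hz : z = 0
        · left
          have hu : u ≠ 0 := fun hu => huz ⟨hu, hz⟩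
          simp [hz, hu, hdQ]
        · exact .inr (pow_ne_zero 2 hz)
      · rw [h, h4]
        push_cast
        linear_combination (4 * (d * e) ^ 2 * z ^ 4 : ℚ_[l]) * hrQ
    · have hdk : ¬(l : ℤ) ∣ d * k := by
        rintro ⟨j, hj⟩
        refine hlprime.not_isUnit (hDsf _ ⟨j, ?_⟩)
        linear_combination (l : ℤ) * hj
      have h2m : ¬(l : ℤ) ∣ 2 ^ m := fun h => hl2 (hlprime.dvd_of_dvd_pow h)
      have hnb : ‖((2 : ℚ_[l]) ^ m) * (l * (d * k)) * z ^ 2‖ = (l : ℝ)⁻¹ * ‖z‖ ^ 2 := by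
        have h1 := Padic.norm_intCast_eq_inv hdk
        have h2 := Padic.norm_intCast_eq_one h2m
        push_cast at h1 h2
        rw [norm_mul, norm_mul, h1, h2, one_mul, norm_pow]
      have hna : ‖(d : ℚ_[l]) * u ^ 2‖ = ‖u‖ ^ 2 := by
        rw [norm_mul, Padic.norm_intCast_eq_one hld, one_mul, norm_pow]
      have hab : ‖(d : ℚ_[l]) * u ^ 2‖ ≠ ‖((2 : ℚ_[l]) ^ m) * (l * (d * k)) * z ^ 2‖ := by
        rw [hna, hnb]
        by_cases hz : z = 0
        · have hu : u ≠ 0 := fun hu => huz ⟨hu, hz⟩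
          simp [hz, hu]
        · exact Padic.norm_sq_ne_inv_mul_norm_sq u hz
      have h2Q : (2 : ℚ_[l]) ^ m ≠ 0 := pow_ne_zero m two_ne_zero
      have hc : ‖-(2 * (p + q) / 2 ^ m : ℚ_[l])‖ ≤ 1 := by
        have h1 := Padic.norm_int_le_one (p := l) (2 * (p + q))
        have h2 := Padic.norm_intCast_eq_one h2m
        push_cast at h1 h2
        rwa [norm_neg, norm_div, h2, div_one]
      refine Padic.isSquare_zmod_of_mul_sq_eq_quadratic hld (w := w) hc hab ?_
      have h4 : (4 : ℚ_[l]) ^ m = (2 ^ m) ^ 2 := by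
        rw [← pow_mul, mul_comm m 2, pow_mul]
        norm_num
      rw [h, h4]
      push_cast
      field_simp
      ring
  · intro hsq
    obtain ⟨s, hs⟩ := Padic.exists_sq_eq_of_isSquare_zmod
      (fun h => hl2 (by simp [h])) hld hsq
    refine ⟨1, 0, s, by simp, ?_⟩
    rw [hs]
    ring
end

section
/- Let ε = 1 and let d be a positive integer with d ∣ D. For every prime l dividing d, one has C_d(ℚ_l) ≠ ∅ if and only if the Legendre symbols (pdD·l⁻²/l) and (qdD·l⁻²/l) both equal 1, where pdD·l⁻² and qdD·l⁻² denote the integers pdD/l² and qdD/l² (note l² ∣ dD since l divides both d and D exactly once). -/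
theorem PadicInt.isSquare_intCast_of_isSquare_zmod {l : ℕ} [Fact l.Prime] (hl : l ≠ 2) {n : ℤ}
    (hn : (n : ZMod l) ≠ 0) (h : IsSquare (n : ZMod l)) : IsSquare (n : ℤ_[l]) := by
  obtain ⟨r, hr⟩ := h
  obtain ⟨k, rfl⟩ := ZMod.intCast_surjective r
  have hdvd : (l : ℤ) ∣ k ^ 2 - n := by
    rw [← ZMod.intCast_zmod_eq_zero_iff_dvd]
    push_cast
    rw [hr]
    ring
  have hndvd : ¬(l : ℤ) ∣ 2 * k := by
    rw [← ZMod.intCast_zmod_eq_zero_iff_dvd]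
    push_cast
    refine mul_ne_zero (fun h2 => hl ?_) (fun hk => hn (by rw [hr, hk, mul_zero]))
    have h2' : ((2 : ℕ) : ZMod l) = 0 := by exact_mod_cast h2
    rw [ZMod.natCast_eq_zero_iff] at h2'
    exact (Nat.prime_dvd_prime_iff_eq Fact.out Nat.prime_two).1 h2'
  have hF : ‖((k ^ 2 - n : ℤ) : ℤ_[l])‖ < 1 := (PadicInt.norm_int_lt_one_iff_dvd _).2 hdvd
  have hF' : ‖((2 * k : ℤ) : ℤ_[l])‖ = 1 :=
    le_antisymm (PadicInt.norm_le_one _)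
      (not_lt.1 fun h => hndvd ((PadicInt.norm_int_lt_one_iff_dvd _).1 h))
  push_cast at hF hF'
  obtain ⟨z, hz, -⟩ := hensels_lemma (p := l) (R := ℤ_[l])
    (F := (Polynomial.X ^ 2 - Polynomial.C (n : ℤ_[l]))) (a := (k : ℤ_[l]))
    (by simpa [hF', one_add_one_eq_two, ← norm_mul] using hF)
  refine ⟨z, ?_⟩
  simp only [map_sub, map_pow, Polynomial.aeval_X, Polynomial.aeval_C, Algebra.algebraMap_self,
    RingHom.id_apply] at hz
  linear_combination -hz

theorem PadicInt.toZMod_eq_zero_iff_norm_lt_one {l : ℕ} [Fact l.Prime] {x : ℤ_[l]} :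
    PadicInt.toZMod x = 0 ↔ ‖x‖ < 1 := by
  rw [← RingHom.mem_ker, PadicInt.ker_toZMod, IsLocalRing.mem_maximalIdeal, PadicInt.mem_nonunits]

theorem Padic.exists_primitive_scaling {l : ℕ} [Fact l.Prime] {u z : ℚ_[l]}
    (h : ¬(u = 0 ∧ z = 0)) :
    ∃ (c : ℚ_[l]) (U Z : ℤ_[l]), c ≠ 0 ∧ u = c * U ∧ z = c * Z ∧ (U = 1 ∨ Z = 1) := by
  rcases le_total ‖u‖ ‖z‖ with hle | hle
  · have hz : z ≠ 0 := by
      rintro rfl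
      exact h ⟨by simpa using hle, rfl⟩
    refine ⟨z, ⟨u / z, ?_⟩, 1, hz, ?_, by simp, Or.inr rfl⟩
    · rw [norm_div]
      exact div_le_one_of_le₀ hle (norm_nonneg _)
    · change u = z * (u / z)
      field_simp
  · have hu : u ≠ 0 := by
      rintro rfl
      exact h ⟨rfl, by simpa using hle⟩
    refine ⟨u, 1, ⟨z / u, ?_⟩, hu, by simp, ?_, Or.inl rfl⟩
    · rw [norm_div]
      exact div_le_one_of_le₀ hle (norm_nonneg _)
    · change z = u * (z / u)
      field_simp

theorem PadicInt.toZMod_eq_zero_of_unit_mul_sq_eq {l : ℕ} [Fact l.Prime] {a : ℤ}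
    (ha : (a : ZMod l) ≠ 0) {w : ℚ_[l]} {G : ℤ_[l]} (h : (a : ℚ_[l]) * w ^ 2 = l * G) :
    PadicInt.toZMod G = 0 := by
  have hl1 : ‖(l : ℚ_[l])‖ < 1 := Padic.norm_p_lt_one
  have ha1 : ‖(a : ℚ_[l])‖ = 1 := by
    refine le_antisymm (Padic.norm_int_le_one a) (not_lt.1 fun hlt => ha ?_)
    rw [ZMod.intCast_zmod_eq_zero_iff_dvd]
    exact Padic.norm_intCast_lt_one_iff.1 hlt
  have hw : ‖w‖ ^ 2 < 1 := by
    have := congrArg norm h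
    rw [norm_mul, norm_mul, norm_pow, ha1, one_mul] at this
    rw [this]
    exact (mul_le_of_le_one_right (norm_nonneg _) (PadicInt.norm_le_one G)).trans_lt hl1
  have hw1 : ‖w‖ < 1 := by
    by_contra! hge
    nlinarith
  obtain ⟨W, rfl⟩ : ∃ W : ℤ_[l], w = W := ⟨⟨w, hw1.le⟩, rfl⟩
  obtain ⟨V, rfl⟩ := (PadicInt.norm_lt_one_iff_dvd W).1 hw1
  have hl0 : (l : ℤ_[l]) ≠ 0 := by exact_mod_cast (Fact.out : l.Prime).ne_zero
  have h' : (a : ℤ_[l]) * (l * V) ^ 2 = l * G := by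
    apply PadicInt.ext
    push_cast at h ⊢
    exact h
  have hG : G = l * (a * V ^ 2) := mul_left_cancel₀ hl0 (by linear_combination -h')
  rw [hG, map_mul, map_natCast, ZMod.natCast_self, zero_mul]

theorem isSquare_mul_of_quartic_eq_zero {F : Type*} [Field F] (h2 : (2 : F) ≠ 0) {a b p q U Z : F}
    (ha : a ≠ 0) (hb : b ≠ 0) (hp : p ≠ 0) (hpq : p ≠ q) (hUZ : U ≠ 0 ∨ Z ≠ 0)
    (h : a ^ 2 * U ^ 4 - 2 * (p + q) * b * a * U ^ 2 * Z ^ 2 + (q - p) ^ 2 * b ^ 2 * Z ^ 4 = 0) :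
    IsSquare (p * a * b) := by
  have hZ : Z ≠ 0 := by
    rintro rfl
    simp_all
  obtain ⟨r, hr⟩ : ∃ r, r * (2 * b * Z ^ 2) = a * U ^ 2 - (p + q) * b * Z ^ 2 :=
    ⟨_, div_mul_cancel₀ _ (by positivity)⟩
  have hr2 : r ^ 2 = p * q := by
    have h0 : (2 * b * Z ^ 2) ^ 2 ≠ 0 := by positivity
    refine mul_right_cancel₀ h0 ?_
    linear_combination (r * (2 * b * Z ^ 2) + (a * U ^ 2 - (p + q) * b * Z ^ 2)) * hr + h
  have hpr : p + r ≠ 0 := by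
    intro h0
    apply hpq
    apply mul_left_cancel₀ hp
    linear_combination hr2 + (p - r) * h0
  have key : p * a * b * U ^ 2 = (b * Z * (p + r)) ^ 2 := by
    linear_combination -p * b * hr - b ^ 2 * Z ^ 2 * hr2
  have hU : U ≠ 0 := by
    rintro rfl
    exact pow_ne_zero 2 (mul_ne_zero (mul_ne_zero hb hZ) hpr) (by rw [← key]; ring)
  refine ⟨b * Z * (p + r) / U, ?_⟩
  rw [← mul_div_mul_comm, eq_div_iff (mul_ne_zero hU hU)]
  linear_combination key

theorem cdPoints_of_isSquare {K : Type} [Field K] {m : ℕ} {p q D d : ℤ} (hpq : q - p = 2 ^ m)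
    (hd : (d : K) ≠ 0) (hp : IsSquare ((p * d * D : ℤ) : K))
    (hq : IsSquare ((q * d * D : ℤ) : K)) : CdPoints K m p q D d := by
  obtain ⟨A, hA⟩ := hp
  obtain ⟨B, hB⟩ := hq
  push_cast at hA hB
  have h4 : (4 : K) ^ m = (q - p) ^ 2 := by
    have : ((q - p : ℤ) : K) = 2 ^ m := by rw [hpq]; push_cast; rfl
    push_cast at this
    rw [this, ← pow_mul, mul_comm, pow_mul]
    norm_num
  refine ⟨A + B, d, 0, fun h => hd h.2, ?_⟩
  rw [h4]
  have hu : (d : K) * (A + B) ^ 2 - (p + q) * D * d ^ 2 = 2 * A * B * d := by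
    linear_combination -(d : K) * hA - d * hB
  have hAB : A * A * (B * B) = p * d * D * (q * d * D) := by rw [hA, hB]
  linear_combination -((d : K) * (A + B) ^ 2 - (p + q) * D * d ^ 2 + 2 * A * B * d) * hu
    - 4 * d ^ 2 * hAB

theorem toZMod_quartic_of_cdPoints {l : ℕ} [Fact l.Prime] {m : ℕ} {p q a b : ℤ}
    (hpq : q - p = 2 ^ m) (ha : (a : ZMod l) ≠ 0) (h : CdPoints ℚ_[l] m p q (l * b) (l * a)) :
    ∃ U Z : ZMod l, (U ≠ 0 ∨ Z ≠ 0) ∧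
      (a : ZMod l) ^ 2 * U ^ 4 - 2 * (p + q) * b * a * U ^ 2 * Z ^ 2
        + (q - p) ^ 2 * b ^ 2 * Z ^ 4 = 0 := by
  obtain ⟨u, z, w, huz, h⟩ := h
  obtain ⟨c, U, Z, hc, rfl, rfl, hUZ⟩ := Padic.exists_primitive_scaling huz
  have hl0 : (l : ℚ_[l]) ≠ 0 := by exact_mod_cast (Fact.out : l.Prime).ne_zero
  have h4 : (4 : ℚ_[l]) ^ m = (q - p) ^ 2 := by
    have : ((q - p : ℤ) : ℚ_[l]) = 2 ^ m := by rw [hpq]; push_cast; rfl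
    push_cast at this
    rw [this, ← pow_mul, mul_comm, pow_mul]
    norm_num
  have key : (a : ℚ_[l]) * (w / c ^ 2) ^ 2 = l * ((a ^ 2 * U ^ 4
      - 2 * (p + q) * b * a * U ^ 2 * Z ^ 2 + (q - p) ^ 2 * b ^ 2 * Z ^ 4 : ℤ_[l]) : ℚ_[l]) := by
    have h2 : ((2 : ℤ_[l]) : ℚ_[l]) = 2 := map_ofNat PadicInt.Coe.ringHom 2
    push_cast [h2] at h ⊢
    rw [h4] at h
    field_simp
    apply mul_left_cancel₀ hl0
    linear_combination h
  have hG := PadicInt.toZMod_eq_zero_of_unit_mul_sq_eq ha key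
  refine ⟨PadicInt.toZMod U, PadicInt.toZMod Z, ?_, by simpa [map_ofNat] using hG⟩
  rcases hUZ with rfl | rfl
  · exact Or.inl (by simp)
  · exact Or.inr (by simp)

theorem stmt10
    (m : ℕ) (hm : 1 ≤ m)
    (p q : ℕ) (hp : p.Prime) (hq : q.Prime) (hpodd : Odd p) (hqodd : Odd q)
    (hpq : (q : ℤ) - (p : ℤ) = 2 ^ m)
    (D : ℤ) (hD0 : 0 < D) (hDsf : Squarefree D) (hDodd : Odd D)
    (hpD : ¬((p : ℤ) ∣ D)) (hqD : ¬((q : ℤ) ∣ D))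
    (d : ℤ) (hd0 : 0 < d) (hdD : d ∣ D) :
    ∀ l : ℕ, ∀ hl : l.Prime, (l : ℤ) ∣ d →
      (letI : Fact l.Prime := ⟨hl⟩;
        (CdPoints ℚ_[l] m (p : ℤ) (q : ℤ) D d ↔
          (legendreSym l ((p : ℤ) * d * D / (l : ℤ) ^ 2) = 1 ∧
            legendreSym l ((q : ℤ) * d * D / (l : ℤ) ^ 2) = 1))) := by
  intro l hl hld
  have : Fact l.Prime := ⟨hl⟩
  obtain ⟨a, rfl⟩ := hld
  obtain ⟨b, rfl⟩ : (l : ℤ) ∣ D := (dvd_mul_right _ _).trans hdD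
  have hlZ : Prime (l : ℤ) := Nat.prime_iff_prime_int.1 hl
  have hlz : (l : ℤ) ≠ 0 := hlZ.ne_zero
  have hb : (b : ZMod l) ≠ 0 := by
    rw [Ne, ZMod.intCast_zmod_eq_zero_iff_dvd]
    exact fun h => hlZ.not_isUnit (hDsf _ (mul_dvd_mul_left _ h))
  have ha : (a : ZMod l) ≠ 0 := by
    rw [Ne, ZMod.intCast_zmod_eq_zero_iff_dvd]
    rw [Ne, ZMod.intCast_zmod_eq_zero_iff_dvd] at hb
    exact fun h => hb (h.trans (Int.dvd_of_mul_dvd_mul_left hlz hdD))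
  have hl2 : l ≠ 2 := by
    rintro rfl
    exact (Int.not_even_iff_odd.2 hDodd) ⟨b, by push_cast; ring⟩
  have h2 : (2 : ZMod l) ≠ 0 := by
    intro h
    have h' : ((2 : ℕ) : ZMod l) = 0 := by exact_mod_cast h
    rw [ZMod.natCast_eq_zero_iff] at h'
    exact hl2 ((Nat.prime_dvd_prime_iff_eq hl Nat.prime_two).1 h')
  have hne {r : ℕ} (hr : r.Prime) (hrD : ¬(r : ℤ) ∣ l * b) : (r : ZMod l) ≠ 0 := by
    rw [Ne, ZMod.natCast_eq_zero_iff]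
    intro h
    obtain rfl := (Nat.prime_dvd_prime_iff_eq hl hr).1 h
    exact hrD (dvd_mul_right _ _)
  have hp0 := hne hp hpD
  have hq0 := hne hq hqD
  have hpqne : (p : ZMod l) ≠ q := by
    intro h
    have h' : ((q - p : ℤ) : ZMod l) = 2 ^ m := by rw [hpq]; push_cast; rfl
    push_cast at h'
    rw [h, sub_self] at h'
    exact pow_ne_zero m h2 h'.symm
  have hdiv (r : ℤ) : r * (l * a) * (l * b) / (l : ℤ) ^ 2 = r * a * b :=
    Int.ediv_eq_of_eq_mul_left (pow_ne_zero 2 hlz) (by ring)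
  have hpab : ((p * a * b : ℤ) : ZMod l) ≠ 0 := by
    push_cast
    exact mul_ne_zero (mul_ne_zero hp0 ha) hb
  have hqab : ((q * a * b : ℤ) : ZMod l) ≠ 0 := by
    push_cast
    exact mul_ne_zero (mul_ne_zero hq0 ha) hb
  rw [hdiv, hdiv, legendreSym.eq_one_iff l hpab, legendreSym.eq_one_iff l hqab]
  constructor
  · intro h
    obtain ⟨U, Z, hUZ, hq4⟩ := toZMod_quartic_of_cdPoints hpq ha h
    push_cast at hq4 ⊢
    exact ⟨isSquare_mul_of_quartic_eq_zero h2 ha hb hp0 hpqne hUZ hq4,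
      isSquare_mul_of_quartic_eq_zero h2 ha hb hq0 hpqne.symm hUZ (by linear_combination hq4)⟩
  · rintro ⟨h₁, h₂⟩
    have lift {r : ℤ} (hr : ((r * a * b : ℤ) : ZMod l) ≠ 0)
        (hs : IsSquare ((r * a * b : ℤ) : ZMod l)) :
        IsSquare ((r * (l * a) * (l * b) : ℤ) : ℚ_[l]) := by
      obtain ⟨s, hs⟩ := PadicInt.isSquare_intCast_of_isSquare_zmod hl2 hr hs
      have hs' := congrArg ((↑) : ℤ_[l] → ℚ_[l]) hs
      push_cast at hs'
      refine ⟨l * s, ?_⟩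
      push_cast
      linear_combination (l : ℚ_[l]) ^ 2 * hs'
    refine cdPoints_of_isSquare hpq ?_ (lift hpab h₁) (lift hqab h₂)
    exact_mod_cast hd0.ne'
end

section
/- Let ε = 1 and m = 1, and let d be a nonzero integer (positive or negative) with d ∣ pD. Then C′_d(ℚ₂) ≠ ∅ if and only if one of the following holds: (a) d ≡ 1 (mod 8); (b) (d + pD)(d + qD) ≡ 0 (mod 16); (c) pqD²/d ≡ 1 (mod 8). -/
/-- A 2-adic number `w` is integral as soon as `d * w ^ 2` is integral for some odd integer `d`. -/
theorem exists_padicInt_of_odd_mul_sq {d : ℤ} (hd : Odd d) {w : ℚ_[2]} {x : ℤ_[2]}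
    (h : (d : ℚ_[2]) * w ^ 2 = x) : ∃ y : ℤ_[2], (y : ℚ_[2]) = w := by
  have hd1 : ‖(d : ℚ_[2])‖ = 1 := Padic.norm_intCast_eq_one_iff.2 (by simpa using hd)
  have hw : ‖w‖ ^ 2 ≤ 1 := by
    have := congrArg norm h
    rw [norm_mul, norm_pow, hd1, one_mul] at this
    rw [this]
    exact x.2
  exact ⟨⟨w, (sq_le_one_iff₀ (norm_nonneg w)).1 hw⟩, rfl⟩

/-- A solution in `ℚ_[2]` of a biquadratic equation `d w² = a + b z² + c z⁴` with `z` integral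
and `d` odd reduces to a solution modulo 16. -/
theorem exists_zmod_sixteen_of_padic {d a b c : ℤ} (hd : Odd d) {w z : ℚ_[2]} (hz : ‖z‖ ≤ 1)
    (h : (d : ℚ_[2]) * w ^ 2 = a + b * z ^ 2 + c * z ^ 4) :
    ∃ w z : ZMod 16, (d : ZMod 16) * w ^ 2 = a + b * z ^ 2 + c * z ^ 4 := by
  obtain ⟨z, rfl⟩ : ∃ z₀ : ℤ_[2], (z₀ : ℚ_[2]) = z := ⟨⟨z, hz⟩, rfl⟩
  obtain ⟨y, rfl⟩ := exists_padicInt_of_odd_mul_sq (x := a + b * z ^ 2 + c * z ^ 4) hd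
    (by rw [h]; push_cast; rfl)
  have h' : (d : ℤ_[2]) * y ^ 2 = a + b * z ^ 2 + c * z ^ 4 := by
    refine Subtype.coe_injective ?_
    push_cast
    exact h
  refine ⟨PadicInt.toZModPow (p := 2) 4 y, PadicInt.toZModPow (p := 2) 4 z, ?_⟩
  have := congrArg (PadicInt.toZModPow (p := 2) 4) h'
  simpa using this

/-- An integer congruent to 1 modulo 8 is a square in `ℤ_[2]`. -/
theorem isSquare_padicInt_of_modEq_one {a : ℤ} (ha : a ≡ 1 [ZMOD 8]) :
    ∃ x : ℤ_[2], x ^ 2 = a := by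
  have h8 : ‖((1 - a : ℤ) : ℤ_[2])‖ ≤ (2 : ℝ) ^ (-3 : ℤ) := by
    have := (PadicInt.norm_int_le_pow_iff_dvd (p := 2) (k := 1 - a) (n := 3)).2
      (by simpa using ha.dvd)
    simpa using this
  have h2 : ‖(2 : ℤ_[2])‖ = 2⁻¹ := by
    simpa using PadicInt.norm_p (p := 2)
  obtain ⟨x, hx, -⟩ := hensels_lemma (p := 2) (R := ℤ_[2])
    (F := Polynomial.X ^ 2 - Polynomial.C (a : ℤ_[2])) (a := 1) (by
      simp only [Polynomial.derivative_sub, Polynomial.derivative_X_pow, Polynomial.derivative_C]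
      push_cast at h8
      simp [h2]
      refine lt_of_le_of_lt h8 ?_
      norm_num)
  exact ⟨x, by simpa [sub_eq_zero] using hx⟩

/-- If `d` is odd and `a ≡ d` modulo 8 then `a / d` is a square in `ℚ_[2]`. -/
theorem exists_padic_mul_sq_eq {a d : ℤ} (hd : Odd d) (h : a ≡ d [ZMOD 8]) :
    ∃ x : ℚ_[2], (d : ℚ_[2]) * x ^ 2 = a := by
  have hdd : d * d ≡ 1 [ZMOD 8] := by
    simpa [sq] using ((Int.modEq_iff_dvd).2 (Int.eight_dvd_sq_sub_one_of_odd hd)).symm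
  obtain ⟨x, hx⟩ := isSquare_padicInt_of_modEq_one ((h.mul_right d).trans hdd)
  have hd0 : (d : ℚ_[2]) ≠ 0 := by
    rintro h0
    rw [Int.cast_eq_zero] at h0
    subst h0
    simp at hd
  have hx' : (x : ℚ_[2]) ^ 2 = a * d := by exact_mod_cast congrArg ((↑) : ℤ_[2] → ℚ_[2]) hx
  refine ⟨x / d, ?_⟩
  rw [div_pow, hx']
  field_simp

/-- The squares modulo 16. -/
theorem zmod_sixteen_sq (x : ZMod 16) : x ^ 2 = 0 ∨ x ^ 2 = 1 ∨ x ^ 2 = 4 ∨ x ^ 2 = 9 := by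
  revert x
  decide

/-- The obstruction modulo 16 to solving `d w² = (d + A z²) (d + (A + 2 D) z²)` with `d`, `A`, `D`
odd. -/
theorem modEq_of_zmod_sixteen {d A D : ℤ} (hd : Odd d) (hA : Odd A) (hD : Odd D) {w z : ZMod 16}
    (h : (d : ZMod 16) * w ^ 2 = (d + A * z ^ 2) * (d + (A + 2 * D) * z ^ 2)) :
    d ≡ 1 [ZMOD 8] ∨ (d + A) * (d + (A + 2 * D)) ≡ 0 [ZMOD 16] := by
  have h16 : (16 : ZMod 16) = 0 := by decide
  have even_case : (d : ZMod 16) * w ^ 2 = d ^ 2 → d ≡ 1 [ZMOD 8] := fun h => by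
    have key : ∀ a : ZMod 16, ∀ W ∈ ({0, 1, 4, 9} : Finset (ZMod 16)),
        (2 * a + 1) * W = (2 * a + 1) ^ 2 → 2 * (2 * a + 1) = 2 := by
      decide
    obtain ⟨a, rfl⟩ := hd
    push_cast at h
    have h1 := key a (w ^ 2) (by simpa using zmod_sixteen_sq w) h
    have := ((ZMod.intCast_eq_intCast_iff (2 * (2 * a + 1)) 2 16).1 (by exact_mod_cast h1)).dvd
    rw [Int.modEq_iff_dvd]
    omega
  obtain ⟨b, hb⟩ := hA.add_odd hD
  obtain ⟨x, hx⟩ := hd.add_odd hA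
  obtain ⟨e, he⟩ : Even (x * (x + D)) := by
    rcases Int.even_or_odd x with hx | hx
    · exact hx.mul_right _
    · exact (hx.add_odd hD).mul_left _
  have hb' : (A : ZMod 16) + D = b + b := by exact_mod_cast congrArg Int.cast hb
  have hx' : (d : ZMod 16) + A = x + x := by exact_mod_cast congrArg Int.cast hx
  have he' : (x : ZMod 16) * (x + D) = e + e := by exact_mod_cast congrArg Int.cast he
  have odd_case : (d : ZMod 16) * w ^ 2 = 8 * e →
      (d + A) * (d + (A + 2 * D)) ≡ 0 [ZMOD 16] := fun h => by
    have key : ∀ a e : ZMod 16, ∀ W ∈ ({0, 1, 4, 9} : Finset (ZMod 16)),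
        (2 * a + 1) * W = 8 * e → 8 * e = 0 := by
      decide +kernel
    obtain ⟨a, rfl⟩ := hd
    push_cast at h hx'
    have h1 := key a e (w ^ 2) (by simpa using zmod_sixteen_sq w) h
    refine (ZMod.intCast_eq_intCast_iff _ _ 16).1 ?_
    push_cast
    linear_combination h1 + 4 * he' + (2 * a + 1 + (A : ZMod 16) + 2 * x + 2 * D) * hx'
  rcases zmod_sixteen_sq z with hz | hz | hz | hz <;> rw [hz] at h
  · exact Or.inl (even_case (by linear_combination h))
  · refine Or.inr (odd_case ?_)
    linear_combination h + 4 * he' + (d + (A : ZMod 16) + 2 * x + 2 * D) * hx'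
  · refine Or.inl (even_case ?_)
    linear_combination h + 8 * (d : ZMod 16) * hb' +
      ((b : ZMod 16) * d + A * (A + 2 * D)) * h16
  · refine Or.inr (odd_case ?_)
    linear_combination h + 4 * he' + (d + 17 * (A : ZMod 16) + 2 * x + 18 * D) * hx' +
      (2 * (A : ZMod 16) * x + 4 * A ^ 2 + 9 * A * D + 2 * x * D) * h16

/-- The 2-adic form of `modEq_of_zmod_sixteen`. -/
theorem modEq_of_padic {d A D : ℤ} (hd : Odd d) (hA : Odd A) (hD : Odd D)
    {w z : ℚ_[2]} (hz : ‖z‖ ≤ 1)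
    (h : (d : ℚ_[2]) * w ^ 2 = (d + A * z ^ 2) * (d + (A + 2 * D) * z ^ 2)) :
    d ≡ 1 [ZMOD 8] ∨ (d + A) * (d + (A + 2 * D)) ≡ 0 [ZMOD 16] := by
  obtain ⟨w', z', h'⟩ := exists_zmod_sixteen_of_padic (a := d ^ 2) (b := d * (2 * (A + D)))
    (c := A * (A + 2 * D)) hd hz (by rw [h]; push_cast; ring)
  refine modEq_of_zmod_sixteen hd hA hD (w := w') (z := z') ?_
  rw [h']
  push_cast
  ring

/-- For odd `d`, `A`, `D` exactly one of `d + A`, `d + A + 2 D` is 2 modulo 4, so divisibility of the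
product by 16 gives divisibility of the other by 8. -/
theorem modEq_neg_of_mul_modEq_zero {d A D : ℤ} (hd : Odd d) (hA : Odd A) (hD : Odd D)
    (h : (d + A) * (d + (A + 2 * D)) ≡ 0 [ZMOD 16]) :
    -A ≡ d [ZMOD 8] ∨ -(A + 2 * D) ≡ d [ZMOD 8] := by
  obtain ⟨x, hx⟩ := hd.add_odd hA
  have hy : d + (A + 2 * D) = 2 * (x + D) := by linarith
  have hdvd : 4 ∣ x * (x + D) := by
    rw [Int.modEq_zero_iff_dvd, hy, hx] at h
    obtain ⟨c, hc⟩ := h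
    exact ⟨c, by linarith⟩
  rw [Int.modEq_iff_dvd, Int.modEq_iff_dvd]
  have coprime_four : ∀ {y : ℤ}, Odd y → IsCoprime 4 y := fun hy =>
    (Int.isCoprime_two_left.2 hy).pow_left (m := 2)
  rcases Int.even_or_odd x with hx2 | hx2
  · have := (coprime_four (hx2.add_odd hD)).dvd_of_dvd_mul_right hdvd
    left
    omega
  · have := (coprime_four hx2).dvd_of_dvd_mul_left hdvd
    right
    omega

theorem stmt12
    (m : ℕ) (hm : 1 ≤ m)
    (p q : ℕ) (hp : p.Prime) (hq : q.Prime) (hpodd : Odd p) (hqodd : Odd q)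
    (hpq : (q : ℤ) - (p : ℤ) = 2 ^ m)
    (D : ℤ) (hD0 : 0 < D) (hDsf : Squarefree D) (hDodd : Odd D)
    (hpD : ¬((p : ℤ) ∣ D)) (hqD : ¬((q : ℤ) ∣ D))
    (hm1 : m = 1)
    (d : ℤ) (hd0 : d ≠ 0) (hdD : d ∣ (p : ℤ) * D) :
    Cd'Points ℚ_[2] (p : ℤ) (q : ℤ) D d ↔
      (d ≡ 1 [ZMOD 8] ∨
        (d + (p : ℤ) * D) * (d + (q : ℤ) * D) ≡ 0 [ZMOD 16] ∨
        (p : ℤ) * (q : ℤ) * D ^ 2 / d ≡ 1 [ZMOD 8]) := by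
  obtain ⟨k, hk⟩ := hdD
  have hq2 : (q : ℤ) = p + 2 := by rw [hm1] at hpq; linarith
  have hA : Odd ((p : ℤ) * D) := (hpodd.natCast (R := ℤ)).mul hDodd
  have hdk : Odd d ∧ Odd k := Int.odd_mul.1 (hk ▸ hA)
  have hqD' : (q : ℤ) * D = p * D + 2 * D := by rw [hq2]; ring
  obtain ⟨e, he⟩ : ∃ e, e = k * (q * D) := ⟨_, rfl⟩
  have hB : Odd ((q : ℤ) * D) := (hqodd.natCast (R := ℤ)).mul hDodd
  have heodd : Odd e := he ▸ hdk.2.mul hB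
  have hed : d * e = (p * D) * (q * D) := by rw [he, hk]; ring
  have hdiv : (p : ℤ) * q * D ^ 2 / d = e :=
    Int.ediv_eq_of_eq_mul_right hd0 (by rw [hed]; ring)
  rw [hdiv]
  have hdQ : (d : ℚ_[2]) ≠ 0 := by exact_mod_cast hd0
  have hedQ : (d : ℚ_[2]) * e = (p * D) * (q * D) := by exact_mod_cast congrArg Int.cast hed
  have hqDQ : (q : ℚ_[2]) * D = p * D + 2 * D := by exact_mod_cast congrArg Int.cast hqD'
  constructor
  · rintro ⟨u, z, w, huz, h⟩
    push_cast at h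
    rcases le_total ‖z‖ ‖u‖ with hle | hle
    · have hu : u ≠ 0 := by
        rintro rfl
        exact huz ⟨rfl, by simpa using hle⟩
      have := modEq_of_padic hdk.1 hA hDodd (w := w / u ^ 2) (z := z / u)
        (by rw [norm_div]; exact div_le_one_of_le₀ hle (norm_nonneg _)) (by
          push_cast
          rw [← hqDQ]
          field_simp
          linear_combination h)
      rw [hqD']
      tauto
    · have hz : z ≠ 0 := by
        rintro rfl
        exact huz ⟨by simpa using hle, rfl⟩
      have hE : (e : ℚ_[2]) * w ^ 2 =
          (e * z ^ 2 + p * D * u ^ 2) * (e * z ^ 2 + q * D * u ^ 2) := by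
        refine mul_left_cancel₀ hdQ ?_
        linear_combination (e : ℚ_[2]) * h +
          ((d : ℚ_[2]) * u ^ 4 - e * z ^ 4) * hedQ
      have := modEq_of_padic heodd hA hDodd (w := w / z ^ 2) (z := u / z)
        (by rw [norm_div]; exact div_le_one_of_le₀ hle (norm_nonneg _)) (by
          push_cast
          rw [← hqDQ]
          field_simp
          linear_combination hE)
      refine Or.inr (this.symm.imp (fun h16 => ?_) id)
      rw [← hqD'] at h16
      have h1 : (p * D * (q * D)) * ((d + p * D) * (d + q * D)) ≡ 0 [ZMOD 16] := by
        have := h16.mul_left (d ^ 2)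
        rw [mul_zero] at this
        convert this using 1
        linear_combination ((-(e : ℤ) * d - p * D * (q * D)) - d * (p * D + q * D)) * hed
      rw [Int.modEq_zero_iff_dvd] at h1 ⊢
      exact ((Int.isCoprime_two_left.2 (hA.mul hB)).pow_left (m := 4)).dvd_of_dvd_mul_left h1
  · rintro (h | h | h)
    · obtain ⟨x, hx⟩ := exists_padic_mul_sq_eq (a := d ^ 2) hdk.1 (by
        simpa [sq] using h.mul_left d)
      exact ⟨1, 0, x, by simp, by push_cast at hx; simp [hx]⟩
    · rw [hqD'] at h
      obtain h | h := modEq_neg_of_mul_modEq_zero hdk.1 hA hDodd h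
      all_goals
        obtain ⟨x, hx⟩ := exists_padic_mul_sq_eq hdk.1 h
        refine ⟨x, 1, 0, by simp, ?_⟩
        push_cast at hx ⊢
      · linear_combination (-((d : ℚ_[2]) * x ^ 2 + q * D)) * hx
      · rw [← hqDQ] at hx
        linear_combination (-((d : ℚ_[2]) * x ^ 2 + p * D)) * hx
    · obtain ⟨x, hx⟩ := exists_padic_mul_sq_eq (a := d * e) hdk.1 (by
        simpa using h.mul_left d)
      refine ⟨0, 1, x, by simp, ?_⟩
      push_cast at hx ⊢
      rw [hx, hedQ]
      ring
end
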